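/- arXiv:1602.08204 — 2 statements merged into one kernel-verified Lean document; each statement's English description precedes it below -/
import Mathlib

section
/- Let X̄ be a partition of 𝒳 and let f = {fₙ}ₙ₌₁^∞ be a sequence of functions fₙ : 𝒳ⁿ × 𝒴ⁿ → 𝒵ₙ such that every fₙ is X̄-informative. Then for every general source (X,Y) that is smooth with respect to Y, the optimal rate for computing f equals the Slepian–Wolf rate of the quotient source: R(X|Y|f) = R_SW([X]_X̄ | Y). -/
/-!
STATEMENT 0: For an X̄-informative sequence of functions f = {fₙ} and any source
(X,Y) smooth with respect to Y, the optimal rate for computing f equals the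
Slepian–Wolf rate of the quotient source: R(X|Y|f) = R_SW([X]_X̄ | Y).

A partition X̄ of 𝒳 is encoded by a surjective map `π : X → B`; the blocks are
the fibers of `π` and `[x]_X̄` corresponds to `π x`.
-/

open Finset Filter

namespace Stmt0

/-- Error probability of a code `(φ, ψ)` for computing `f` under joint pmf `p`. -/
noncomputable def errProb {A Y Z : Type} [Fintype A] [Fintype Y] [DecidableEq Z]
    {n M : ℕ} (p : (Fin n → A) → (Fin n → Y) → ℝ)
    (f : (Fin n → A) → (Fin n → Y) → Z)
    (φ : (Fin n → A) → Fin M) (ψ : Fin M → (Fin n → Y) → Z) : ℝ :=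
  ∑ x : Fin n → A, ∑ y : Fin n → Y, if ψ (φ x) y = f x y then 0 else p x y

/-- A rate `R ≥ 0` is achievable for computing the sequence of functions `f` on the
general source `p` if there are codes whose error probability vanishes and whose
rate is asymptotically at most `R` (i.e. `limsup (1/n) log₂ |Mₙ| ≤ R`). -/
def Achievable {A Y : Type} [Fintype A] [Fintype Y]
    (p : ∀ n, (Fin n → A) → (Fin n → Y) → ℝ)
    {Z : ℕ → Type} [∀ n, DecidableEq (Z n)]
    (f : ∀ n, (Fin n → A) → (Fin n → Y) → Z n) (R : ℝ) : Prop :=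
  0 ≤ R ∧
  ∃ M : ℕ → ℕ, ∃ φ : ∀ n, (Fin n → A) → Fin (M n),
    ∃ ψ : ∀ n, Fin (M n) → (Fin n → Y) → Z n,
      Tendsto (fun n => errProb (p n) (f n) (φ n) (ψ n)) atTop (nhds 0) ∧
      ∀ ε : ℝ, 0 < ε → ∀ᶠ n : ℕ in atTop, Real.logb 2 (M n) / n ≤ R + ε

/-- The optimal rate `R(X|Y|f)`: the infimum of achievable rates. -/
noncomputable def optRate {A Y : Type} [Fintype A] [Fintype Y]
    (p : ∀ n, (Fin n → A) → (Fin n → Y) → ℝ)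
    {Z : ℕ → Type} [∀ n, DecidableEq (Z n)]
    (f : ∀ n, (Fin n → A) → (Fin n → Y) → Z n) : ℝ :=
  sInf {R | Achievable p f R}

/-- Condition 1 of X̄-informativity (partition encoded by `π : X → B`). -/
def Cond1 {X Y B Z : Type} {n : ℕ} (π : X → B)
    (f : (Fin n → X) → (Fin n → Y) → Z) : Prop :=
  ∀ i : Fin n, ∃ ξ : (Y → Z) → B, ∀ (a : X) (x : Fin n → X) (y : Fin n → Y),
    ξ (fun b => f (Function.update x i a) (Function.update y i b)) = π a

/-- Condition 2 of X̄-informativity. -/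
def Cond2 {X Y B Z : Type} {n : ℕ} (π : X → B)
    (f : (Fin n → X) → (Fin n → Y) → Z) : Prop :=
  ∀ (x : Fin n → X) (y : Fin n → Y) (σ : Equiv.Perm (Fin n)),
    π ∘ (x ∘ σ) = π ∘ x → f (x ∘ σ) y = f x y

/-- The quotient source `([Xⁿ]_X̄, Yⁿ)` induced by the partition `π`. -/
noncomputable def quotSource {X Y B : Type} [Fintype X] [DecidableEq B]
    (π : X → B) (p : ∀ n, (Fin n → X) → (Fin n → Y) → ℝ) :
    ∀ n, (Fin n → B) → (Fin n → Y) → ℝ :=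
  fun n xb y => ∑ x ∈ Finset.univ.filter (fun x : Fin n → X => π ∘ x = xb), p n x y

/-- Random binning: a list decoder yields a hash code. -/
lemma exists_hash {A Y : Type} [Fintype A] [Fintype Y] [DecidableEq A] [Nonempty A]
    (P : A → Y → ℝ) (hP0 : ∀ x y, 0 ≤ P x y) (hP1 : ∑ x, ∑ y, P x y = 1)
    (L : Y → Finset A) (K : ℝ) (hK : ∀ y, ((L y).card : ℝ) ≤ K) (N : ℕ) (hN : 0 < N) :
    ∃ (φ : A → Fin N) (ψ : Fin N → Y → A),
      (∑ x, ∑ y, if ψ (φ x) y = x then 0 else P x y)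
        ≤ (∑ x, ∑ y, if x ∈ L y then 0 else P x y) + K / N := by
  classical
  let ψ : (A → Fin N) → Fin N → Y → A := fun h m y =>
    if H : ∃ x ∈ L y, h x = m then H.choose else Classical.arbitrary A
  let C : A → A → (A → Fin N) → ℝ := fun x x' h => if x ≠ x' ∧ h x = h x' then 1 else 0
  have hpt : ∀ h x y, (if ψ h (h x) y = x then 0 else P x y)
      ≤ (if x ∈ L y then 0 else P x y) + ∑ x' ∈ L y, C x x' h * P x y := by
    intro h x y
    have hs : ∀ x' ∈ L y, 0 ≤ C x x' h * P x y := by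
      intro x' _
      apply mul_nonneg _ (hP0 x y)
      simp only [C]; split_ifs <;> norm_num
    by_cases hx : x ∈ L y
    · have H : ∃ x' ∈ L y, h x' = h x := ⟨x, hx, rfl⟩
      by_cases he : ψ h (h x) y = x
      · simp only [he, hx, if_true]
        have := Finset.sum_nonneg hs
        linarith
      · have hc := H.choose_spec
        have hψ : ψ h (h x) y = H.choose := by simp only [ψ]; rw [dif_pos H]
        rw [hψ] at he ⊢
        have := Finset.single_le_sum hs hc.1
        have h1 : C x H.choose h = 1 := by
          simp only [C]; rw [if_pos]; exact ⟨fun e => he e.symm, hc.2.symm⟩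
        rw [h1] at this
        simp only [he, hx, if_true, if_false]
        linarith
    · have := Finset.sum_nonneg hs
      simp only [hx, if_false]
      split_ifs <;> linarith [hP0 x y]
  have hNr : (0:ℝ) < N := by exact_mod_cast hN
  have hcount : ∀ x x', ∑ h : A → Fin N, C x x' h ≤ (Fintype.card (A → Fin N) : ℝ) / N := by
    intro x x'
    rw [le_div_iff₀ hNr]
    by_cases hxx : x = x'
    · simp [C, hxx]
    simp only [C]
    rw [Finset.sum_boole]
    have := Fintype.card_le_of_injective
      (fun z : {h : A → Fin N // x ≠ x' ∧ h x = h x'} × Fin N => Function.update z.1.1 x' z.2) (by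
        rintro ⟨⟨h, h1, h2⟩, m⟩ ⟨⟨g, g1, g2⟩, k⟩ e
        have e' : ∀ a, Function.update h x' m a = Function.update g x' k a := fun a => congrFun e a
        have e1 := e' x'
        simp at e1
        have : h = g := by
          funext a
          have ea := e' a
          have ex := e' x
          by_cases haa : a = x'
          · subst haa
            rw [Function.update_of_ne hxx, Function.update_of_ne hxx] at ex
            rw [← h2, ← g2, ex]
          · rwa [Function.update_of_ne haa, Function.update_of_ne haa] at ea
        subst this; subst e1; rfl)
    rw [Fintype.card_prod, Fintype.card_fin, Fintype.card_subtype] at this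
    exact_mod_cast this
  set e0 := ∑ x, ∑ y, if x ∈ L y then 0 else P x y with he0
  haveI : Nonempty (Fin N) := ⟨⟨0, hN⟩⟩
  have hsum : ∑ h : A → Fin N, (∑ x, ∑ y, if ψ h (h x) y = x then 0 else P x y)
      ≤ ∑ h : A → Fin N, (e0 + K / N) := by
    calc _ ≤ ∑ h : A → Fin N, ∑ x, ∑ y, ((if x ∈ L y then 0 else P x y)
            + ∑ x' ∈ L y, C x x' h * P x y) := by
          gcongr with h _ x _ y _
          exact hpt h x y
      _ = ∑ h : A → Fin N, e0 + ∑ x, ∑ y, (∑ x' ∈ L y, ∑ h : A → Fin N, C x x' h) * P x y := by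
          simp only [Finset.sum_add_distrib]
          congr 1
          rw [Finset.sum_comm]
          refine Finset.sum_congr rfl fun x _ => ?_
          rw [Finset.sum_comm]
          refine Finset.sum_congr rfl fun y _ => ?_
          rw [Finset.sum_comm, Finset.sum_mul]
          refine Finset.sum_congr rfl fun x' _ => ?_
          rw [Finset.sum_mul]
      _ ≤ ∑ h : A → Fin N, e0 + ∑ x, ∑ y, (K * ((Fintype.card (A → Fin N) : ℝ) / N)) * P x y := by
          gcongr with x _ y _
          · exact hP0 x y
          · calc _ ≤ ∑ x' ∈ L y, (Fintype.card (A → Fin N) : ℝ) / N :=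
                  Finset.sum_le_sum fun x' _ => hcount x x'
              _ = (L y).card * ((Fintype.card (A → Fin N) : ℝ) / N) := by
                  rw [Finset.sum_const, nsmul_eq_mul]
              _ ≤ _ := by
                  gcongr
                  exact hK y
      _ = _ := by
          simp only [← Finset.mul_sum, hP1, Finset.sum_add_distrib, Finset.sum_const,
            nsmul_eq_mul, Finset.card_univ]
          ring
  obtain ⟨h, _, hh⟩ := Finset.exists_le_of_sum_le Finset.univ_nonempty hsum
  exact ⟨h, ψ h, hh⟩

/-- Hamming ball bound. -/
lemma ball_bound {B : Type} [Fintype B] [DecidableEq B] (n : ℕ) (c : Fin n → B) (t : ℝ)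
    (ht : 1 ≤ t) (r : ℝ) :
    (((Finset.univ.filter fun x : Fin n → B => (hammingDist x c : ℝ) ≤ r).card : ℕ) : ℝ)
      ≤ t ^ r * (1 + Fintype.card B / t) ^ n := by
  have ht0 : 0 < t := by linarith
  have hprod : ∀ x : Fin n → B, ∏ i, (if x i = c i then 1 else t⁻¹) = t⁻¹ ^ (hammingDist x c) := by
    intro x
    rw [Finset.prod_ite]
    simp [hammingDist]
  have hsum : ∑ x : Fin n → B, t⁻¹ ^ (hammingDist x c) ≤ (1 + Fintype.card B / t) ^ n := by
    simp only [← hprod]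
    rw [← Fintype.prod_sum (fun i b => if b = c i then (1:ℝ) else t⁻¹)]
    calc _ ≤ ∏ i : Fin n, (1 + Fintype.card B / t) := by
          apply Finset.prod_le_prod
          · intro i _
            apply Finset.sum_nonneg
            intro b _
            split_ifs <;> positivity
          · intro i _
            calc _ ≤ ∑ b : B, ((if b = c i then (1:ℝ) else 0) + t⁻¹) := by
                  apply Finset.sum_le_sum
                  intro b _
                  have : 0 < t⁻¹ := by positivity
                  split_ifs <;> linarith
              _ = _ := by
                  rw [Finset.sum_add_distrib]
                  simp [div_eq_mul_inv]
      _ = _ := by simp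
  have htr : 0 < t ^ r := Real.rpow_pos_of_pos ht0 r
  calc _ = ∑ x ∈ Finset.univ.filter (fun x : Fin n → B => (hammingDist x c : ℝ) ≤ r), (1:ℝ) := by simp
    _ ≤ ∑ x ∈ Finset.univ.filter (fun x : Fin n → B => (hammingDist x c : ℝ) ≤ r),
          t ^ r * t⁻¹ ^ (hammingDist x c) := by
        apply Finset.sum_le_sum
        intro x hx
        rw [Finset.mem_filter] at hx
        rw [inv_pow, ← div_eq_mul_inv, le_div_iff₀ (by positivity), one_mul, ← Real.rpow_natCast]
        exact Real.rpow_le_rpow_of_exponent_le ht hx.2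
    _ ≤ ∑ x : Fin n → B, t ^ r * t⁻¹ ^ (hammingDist x c) := by
        apply Finset.sum_le_sum_of_subset_of_nonneg (Finset.filter_subset _ _)
        intros; positivity
    _ ≤ _ := by
        rw [← Finset.mul_sum]
        gcongr

lemma sum_update {Y : Type} [Fintype Y] {n : ℕ} (i : Fin n) (g : (Fin n → Y) → ℝ) :
    ∑ b : Y, ∑ y : Fin n → Y, g (Function.update y i b) = Fintype.card Y * ∑ y, g y := by
  have hinv : Function.Involutive
      (fun z : Y × (Fin n → Y) => (z.2 i, Function.update z.2 i z.1)) := by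
    rintro ⟨b, y⟩
    simp
  have := Equiv.sum_comp (hinv.toPerm _) (fun z : Y × (Fin n → Y) => g z.2)
  rw [Fintype.sum_prod_type, Fintype.sum_prod_type] at this
  simpa using this

lemma quot_sum {X Y B : Type} [Fintype X] [Fintype Y] [Fintype B] [DecidableEq B]
    (π : X → B) (p : ∀ n, (Fin n → X) → (Fin n → Y) → ℝ) (n : ℕ)
    (S : (Fin n → B) → (Fin n → Y) → Prop) [∀ x y, Decidable (S x y)] :
    ∑ xb, ∑ y, (if S xb y then 0 else quotSource π p n xb y)
      = ∑ x, ∑ y, if S (π ∘ x) y then 0 else p n x y := by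
  rw [Finset.sum_comm]
  conv_rhs => rw [Finset.sum_comm]
  refine Finset.sum_congr rfl fun y _ => ?_
  rw [← Finset.sum_fiberwise (s := Finset.univ) (g := fun x : Fin n → X => π ∘ x)]
  refine Finset.sum_congr rfl fun xb _ => ?_
  unfold quotSource
  split_ifs with h
  · symm
    apply Finset.sum_eq_zero
    intro x hx
    rw [Finset.mem_filter] at hx
    rw [hx.2, if_pos h]
  · apply Finset.sum_congr rfl
    intro x hx
    rw [Finset.mem_filter] at hx
    rw [hx.2, if_neg h]

/-- Decoding the blocks coordinatewise has small expected distortion. -/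
lemma expected_dist {X Y B Z : Type} [Fintype X] [Fintype Y] [DecidableEq Y] [DecidableEq B]
    [DecidableEq Z] {n M : ℕ} (π : X → B) (f : (Fin n → X) → (Fin n → Y) → Z)
    (hf : Cond1 π f) (p : (Fin n → X) → (Fin n → Y) → ℝ) (hp0 : ∀ x y, 0 ≤ p x y)
    (q : ℝ) (hq0 : 0 < q) (hq1 : q < 1)
    (hs : ∀ (x : Fin n → X) (y y' : Fin n → Y), hammingDist y y' = 1 → q * p x y ≤ p x y')
    (φ : (Fin n → X) → Fin M) (ψ : Fin M → (Fin n → Y) → Z) :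
    ∃ D : Fin M → (Fin n → Y) → (Fin n → B),
      q * ∑ x, ∑ y, hammingDist (π ∘ x) (D (φ x) y) * p x y
        ≤ n * (Fintype.card Y * errProb p f φ ψ) := by
  choose ξ hξ using hf
  let D : Fin M → (Fin n → Y) → (Fin n → B) := fun m y i =>
    ξ i (fun b => ψ m (Function.update y i b))
  refine ⟨D, ?_⟩
  let E : (Fin n → X) → (Fin n → Y) → ℝ := fun x y => if ψ (φ x) y = f x y then 0 else 1
  have hE0 : ∀ x y, 0 ≤ E x y := by
    intro x y; simp only [E]; split_ifs <;> norm_num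
  have hd : ∀ x y, (hammingDist (π ∘ x) (D (φ x) y) : ℝ)
      ≤ ∑ i, ∑ b, E x (Function.update y i b) := by
    intro x y
    unfold hammingDist
    rw [← Finset.sum_boole]
    apply Finset.sum_le_sum
    intro i _
    split_ifs with h
    · by_contra hlt
      apply h
      have hall : ∀ b, ψ (φ x) (Function.update y i b) = f x (Function.update y i b) := by
        intro b
        by_contra hb
        apply hlt
        have := Finset.single_le_sum (f := fun b => E x (Function.update y i b))
          (fun b _ => hE0 _ _) (Finset.mem_univ b)
        simpa [E, hb] using this
      have := hξ i (x i) x y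
      rw [Function.update_eq_self] at this
      simp only [D, Function.comp, hall, this]
    · exact Finset.sum_nonneg fun b _ => hE0 _ _
  have hsm : ∀ x y i b, q * p x y ≤ p x (Function.update y i b) := by
    intro x y i b
    by_cases hb : y i = b
    · subst hb
      rw [Function.update_eq_self]
      nlinarith [hp0 x y]
    · apply hs
      unfold hammingDist
      rw [Finset.card_eq_one]
      refine ⟨i, ?_⟩
      ext j
      by_cases hj : j = i
      · subst hj; simp [hb]
      · simp [hj]
  calc q * ∑ x, ∑ y, hammingDist (π ∘ x) (D (φ x) y) * p x y
      ≤ ∑ x, ∑ y, ∑ i, ∑ b, E x (Function.update y i b) * p x (Function.update y i b) := by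
        rw [Finset.mul_sum]
        apply Finset.sum_le_sum; intro x _
        rw [Finset.mul_sum]
        apply Finset.sum_le_sum; intro y _
        calc q * (hammingDist (π ∘ x) (D (φ x) y) * p x y)
            = hammingDist (π ∘ x) (D (φ x) y) * (q * p x y) := by ring
          _ ≤ (∑ i, ∑ b, E x (Function.update y i b)) * (q * p x y) :=
              mul_le_mul_of_nonneg_right (hd x y) (mul_nonneg hq0.le (hp0 x y))
          _ ≤ _ := by
              rw [Finset.sum_mul]
              apply Finset.sum_le_sum; intro i _
              rw [Finset.sum_mul]
              apply Finset.sum_le_sum; intro b _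
              exact mul_le_mul_of_nonneg_left (hsm x y i b) (hE0 _ _)
    _ = ∑ x, ∑ i : Fin n, (Fintype.card Y * ∑ y, E x y * p x y) := by
        apply Finset.sum_congr rfl; intro x _
        rw [Finset.sum_comm]
        apply Finset.sum_congr rfl; intro i _
        rw [Finset.sum_comm]
        exact sum_update i (fun y => E x y * p x y)
    _ = _ := by
        simp only [Finset.sum_const, Finset.card_univ, Fintype.card_fin, nsmul_eq_mul,
          ← Finset.mul_sum, errProb]
        congr 3
        funext x
        apply Finset.sum_congr rfl; intro y _
        simp only [E]; split_ifs <;> simp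

lemma exists_perm {X : Type} [DecidableEq X] {n : ℕ} (x x' : Fin n → X)
    (h : ∀ a, (Finset.univ.filter fun i => x i = a).card
      = (Finset.univ.filter fun i => x' i = a).card) :
    ∃ σ : Equiv.Perm (Fin n), x ∘ σ = x' := by
  have e : ∀ a, Nonempty ({i // x' i = a} ≃ {i // x i = a}) := by
    intro a
    apply Fintype.card_eq.1
    rw [Fintype.card_subtype, Fintype.card_subtype, h]
  let e' := fun a => (e a).some
  refine ⟨(Equiv.sigmaFiberEquiv x').symm.trans
    ((Equiv.sigmaCongrRight e').trans (Equiv.sigmaFiberEquiv x)), ?_⟩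
  funext i
  exact (e' (x' i) ⟨i, rfl⟩).2

/-- One-shot direct part. -/
lemma direct_code {X Y B Z : Type} [Fintype X] [Fintype Y] [Fintype B] [DecidableEq X]
    [DecidableEq B] [DecidableEq Z] [Nonempty X] (π : X → B) {n M : ℕ}
    (p : ∀ n, (Fin n → X) → (Fin n → Y) → ℝ) (hp0 : ∀ n x y, 0 ≤ p n x y)
    (f : (Fin n → X) → (Fin n → Y) → Z) (hf : Cond2 π f)
    (φ : (Fin n → B) → Fin M) (ψ : Fin M → (Fin n → Y) → (Fin n → B)) :
    ∃ (φ' : (Fin n → X) → Fin (M * (n + 1) ^ Fintype.card X))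
      (ψ' : Fin (M * (n + 1) ^ Fintype.card X) → (Fin n → Y) → Z),
      errProb (p n) f φ' ψ' ≤ errProb (quotSource π p n) (fun xb _ => xb) φ ψ := by
  classical
  let e : Fin M × (X → Fin (n + 1)) ≃ Fin (M * (n + 1) ^ Fintype.card X) :=
    Fintype.equivFinOfCardEq (by simp)
  let T : (Fin n → X) → X → Fin (n + 1) := fun x a =>
    ⟨(Finset.univ.filter fun i => x i = a).card, by
      have := Finset.card_filter_le (Finset.univ : Finset (Fin n)) (fun i => x i = a)
      simp only [Finset.card_univ, Fintype.card_fin] at this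
      omega⟩
  let rec' : Fin M × (X → Fin (n + 1)) → (Fin n → Y) → Z := fun m y =>
    if H : ∃ x, π ∘ x = ψ m.1 y ∧ T x = m.2 then f H.choose y
    else f (Classical.arbitrary _) y
  refine ⟨fun x => e (φ (π ∘ x), T x), fun m y => rec' (e.symm m) y, ?_⟩
  have := quot_sum π p n (fun xb y => ψ (φ xb) y = xb)
  unfold errProb
  rw [this]
  apply Finset.sum_le_sum; intro x _
  apply Finset.sum_le_sum; intro y _
  by_cases h : ψ (φ (π ∘ x)) y = π ∘ x
  · have H : ∃ x', π ∘ x' = ψ (φ (π ∘ x)) y ∧ T x' = T x := ⟨x, h.symm, rfl⟩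
    have hr : rec' (φ (π ∘ x), T x) y = f x y := by
      simp only [rec']
      rw [dif_pos H]
      obtain ⟨h1, h2⟩ := H.choose_spec
      obtain ⟨σ, hσ⟩ := exists_perm x H.choose (fun a => by
        have := congrFun h2 a
        simp only [T, Fin.mk.injEq] at this
        exact this.symm)
      rw [← hσ] at h1 ⊢
      exact hf x y σ (h1.trans h)
    simp [hr, h]
  · simp only [h, if_false]
    split_ifs
    · exact hp0 n x y
    · exact le_rfl

lemma tendsto_log_div : Tendsto (fun n : ℕ => Real.logb 2 ((n : ℝ) + 1) / n) atTop (nhds 0) := by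
  have h1 : Tendsto (fun x : ℝ => Real.log x / x) atTop (nhds 0) :=
    Real.isLittleO_log_id_atTop.tendsto_div_nhds_zero
  have h2 : Tendsto (fun n : ℕ => ((n : ℝ) + 1)) atTop atTop :=
    tendsto_atTop_add_const_right _ _ tendsto_natCast_atTop_atTop
  have h3 := (h1.comp h2).const_mul (2 / Real.log 2)
  rw [mul_zero] at h3
  refine squeeze_zero' (Eventually.of_forall fun n => ?_) ?_ h3
  · apply div_nonneg _ (Nat.cast_nonneg n)
    apply Real.logb_nonneg (by norm_num)
    linarith [(Nat.cast_nonneg n : (0:ℝ) ≤ n)]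
  · filter_upwards [eventually_ge_atTop 1] with n hn
    have hn' : (1:ℝ) ≤ n := by exact_mod_cast hn
    have hl : 0 < Real.log 2 := Real.log_pos (by norm_num)
    have hl' : 0 ≤ Real.log ((n:ℝ) + 1) := Real.log_nonneg (by linarith)
    simp only [Function.comp, Real.logb]
    rw [div_div, div_mul_div_comm, div_le_div_iff₀ (by positivity) (by positivity)]
    have : Real.log ((n:ℝ)+1) * Real.log 2 * (n + 1) ≤ Real.log ((n:ℝ)+1) * Real.log 2 * (2 * n) := by
      apply mul_le_mul_of_nonneg_left (by linarith) (by positivity)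
    nlinarith

lemma errProb_nonneg {A Y Z : Type} [Fintype A] [Fintype Y] [DecidableEq Z]
    {n M : ℕ} (p : (Fin n → A) → (Fin n → Y) → ℝ) (hp : ∀ x y, 0 ≤ p x y)
    (f : (Fin n → A) → (Fin n → Y) → Z)
    (φ : (Fin n → A) → Fin M) (ψ : Fin M → (Fin n → Y) → Z) : 0 ≤ errProb p f φ ψ := by
  apply Finset.sum_nonneg; intro x _
  apply Finset.sum_nonneg; intro y _
  split_ifs
  · exact le_rfl
  · exact hp x y

lemma quot_nonneg {X Y B : Type} [Fintype X] [DecidableEq B]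
    (π : X → B) (p : ∀ n, (Fin n → X) → (Fin n → Y) → ℝ) (hp0 : ∀ n x y, 0 ≤ p n x y) :
    ∀ n x y, 0 ≤ quotSource π p n x y :=
  fun n _ y => Finset.sum_nonneg fun x _ => hp0 n x y

lemma achievable_direct
    {X Y B : Type} [Fintype X] [Fintype Y] [Fintype B]
    [Nonempty X] [DecidableEq X] [DecidableEq B]
    (π : X → B) {Z : ℕ → Type} [∀ n, DecidableEq (Z n)]
    (f : ∀ n, (Fin n → X) → (Fin n → Y) → Z n)
    (hf : ∀ n, Cond2 π (f n))
    (p : ∀ n, (Fin n → X) → (Fin n → Y) → ℝ)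
    (hp0 : ∀ n x y, 0 ≤ p n x y) (R : ℝ)
    (hR : Achievable (quotSource π p) (fun n (xb : Fin n → B) (_ : Fin n → Y) => xb) R) :
    Achievable p f R := by
  obtain ⟨hR0, M, φ, ψ, herr, hrate⟩ := hR
  choose φ' ψ' h' using fun n => direct_code (M := M n) π p hp0 (f n) (hf n) (φ n) (ψ n)
  refine ⟨hR0, fun n => M n * (n + 1) ^ Fintype.card X, φ', ψ', ?_, ?_⟩
  · exact squeeze_zero (fun n => errProb_nonneg _ (hp0 n) _ _ _) h' herr
  · intro ε hε
    have h3 := tendsto_log_div.const_mul (Fintype.card X : ℝ)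
    rw [mul_zero] at h3
    filter_upwards [hrate (ε / 2) (by linarith), h3.eventually (gt_mem_nhds (half_pos hε))]
      with n h1 h2
    have hM : (M n : ℝ) ≠ 0 := by
      have : 0 < M n := Fin.pos (φ n (fun _ => π (Classical.arbitrary X)))
      exact_mod_cast this.ne'
    have hn1 : ((n:ℝ) + 1) ≠ 0 := by positivity
    push_cast
    rw [Real.logb_mul hM (pow_ne_zero _ hn1), Real.logb_pow, add_div, mul_div_assoc]
    linarith

lemma exists_params (b : ℕ) (γ : ℝ) (hγ : 0 < γ) :
    ∃ t δ : ℝ, 1 ≤ t ∧ 0 < δ ∧ ∀ n : ℕ, t ^ (δ * n) * (1 + b / t) ^ n ≤ (2:ℝ) ^ (γ * n) := by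
  have hg : 0 < (2:ℝ) ^ (γ / 2) - 1 := by
    have := Real.one_lt_rpow (x := 2) (by norm_num) (half_pos hγ)
    linarith
  let t : ℝ := max 2 (b / ((2:ℝ) ^ (γ / 2) - 1))
  have ht2 : 2 ≤ t := le_max_left _ _
  have ht0 : 0 < t := by linarith
  have htb : b / ((2:ℝ) ^ (γ / 2) - 1) ≤ t := le_max_right _ _
  have hb : 1 + b / t ≤ (2:ℝ) ^ (γ / 2) := by
    rw [div_le_iff₀ hg] at htb
    have : b / t ≤ (2:ℝ) ^ (γ / 2) - 1 := by
      rw [div_le_iff₀ ht0]; linarith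
    linarith
  have hlt : 0 < Real.logb 2 t := Real.logb_pos (by norm_num) (by linarith)
  refine ⟨t, γ / 2 / Real.logb 2 t, by linarith, by positivity, fun n => ?_⟩
  have h1 : t ^ (γ / 2 / Real.logb 2 t * n) = (2:ℝ) ^ (γ / 2 * n) := by
    conv_lhs => rw [← Real.rpow_logb (b := 2) (x := t) (by norm_num) (by norm_num) ht0]
    rw [← Real.rpow_mul (by norm_num), Real.rpow_logb (by norm_num) (by norm_num) ht0]
    congr 1
    field_simp
  calc _ ≤ (2:ℝ) ^ (γ / 2 * n) * ((2:ℝ) ^ (γ / 2)) ^ n := by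
        rw [h1]; gcongr
    _ = _ := by
        rw [← Real.rpow_natCast, ← Real.rpow_mul (by norm_num), ← Real.rpow_add (by norm_num)]
        congr 1; ring

/-- One-shot converse part. -/
lemma converse_code {X Y B Z : Type} [Fintype X] [Fintype Y] [Fintype B]
    [DecidableEq Y] [DecidableEq B] [DecidableEq Z] [Nonempty B] (π : X → B) {n M : ℕ}
    (p : ∀ n, (Fin n → X) → (Fin n → Y) → ℝ) (hp0 : ∀ n x y, 0 ≤ p n x y)
    (hp1 : ∀ n, ∑ x : (Fin n → X), ∑ y : (Fin n → Y), p n x y = 1)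
    (q : ℝ) (hq0 : 0 < q) (hq1 : q < 1)
    (hs : ∀ (x : Fin n → X) (y y' : Fin n → Y), hammingDist y y' = 1 → q * p n x y ≤ p n x y')
    (f : (Fin n → X) → (Fin n → Y) → Z) (hf : Cond1 π f)
    (φ : (Fin n → X) → Fin M) (ψ : Fin M → (Fin n → Y) → Z)
    (t δ : ℝ) (ht : 1 ≤ t) (hδ : 0 < δ) (N : ℕ) (hN : 0 < N) :
    ∃ (φ' : (Fin n → B) → Fin N) (ψ' : Fin N → (Fin n → Y) → (Fin n → B)),
      0 < n → errProb (quotSource π p n) (fun xb _ => xb) φ' ψ' ≤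
        Fintype.card Y / (q * δ) * errProb (p n) f φ ψ
          + (M * (t ^ (δ * n) * (1 + Fintype.card B / t) ^ n)) / N := by
  classical
  obtain ⟨D, hD⟩ := expected_dist π f hf (p n) (hp0 n) q hq0 hq1 hs φ ψ
  let L : (Fin n → Y) → Finset (Fin n → B) := fun y =>
    Finset.univ.biUnion fun m : Fin M =>
      Finset.univ.filter fun x : Fin n → B => (hammingDist x (D m y) : ℝ) ≤ δ * n
  have hL : ∀ y, ((L y).card : ℝ) ≤ M * (t ^ (δ * n) * (1 + Fintype.card B / t) ^ n) := by
    intro y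
    calc ((L y).card : ℝ) ≤ ((∑ m : Fin M, (Finset.univ.filter fun x : Fin n → B =>
            (hammingDist x (D m y) : ℝ) ≤ δ * n).card : ℕ) : ℝ) := by
          exact_mod_cast Finset.card_biUnion_le
      _ ≤ ∑ m : Fin M, (t ^ (δ * n) * (1 + Fintype.card B / t) ^ n) := by
          push_cast
          exact Finset.sum_le_sum fun m _ => ball_bound n (D m y) t ht (δ * n)
      _ = _ := by simp
  have hQ1 : ∑ x, ∑ y, quotSource π p n x y = 1 := by
    have := quot_sum π p n (fun _ _ => False)
    simp only [if_false] at this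
    rw [this, hp1]
  obtain ⟨φ', ψ', h'⟩ := exists_hash (quotSource π p n) (quot_nonneg π p hp0 n) hQ1 L _ hL N hN
  refine ⟨φ', ψ', fun hn => ?_⟩
  refine le_trans h' ?_
  gcongr
  rw [quot_sum π p n (fun xb y => xb ∈ L y)]
  have hn' : (0:ℝ) < n := by exact_mod_cast hn
  have hmk : (δ * n) * (∑ x, ∑ y, if π ∘ x ∈ L y then 0 else p n x y)
      ≤ ∑ x, ∑ y, hammingDist (π ∘ x) (D (φ x) y) * p n x y := by
    rw [Finset.mul_sum]
    apply Finset.sum_le_sum; intro x _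
    rw [Finset.mul_sum]
    apply Finset.sum_le_sum; intro y _
    split_ifs with h
    · rw [mul_zero]
      exact mul_nonneg (Nat.cast_nonneg _) (hp0 n x y)
    · apply mul_le_mul_of_nonneg_right _ (hp0 n x y)
      by_contra hlt
      apply h
      simp only [L, Finset.mem_biUnion, Finset.mem_filter, Finset.mem_univ, true_and]
      exact ⟨φ x, (not_le.1 hlt).le⟩
  have h2 := (mul_le_mul_of_nonneg_left hmk hq0.le).trans hD
  rw [div_mul_eq_mul_div, le_div_iff₀ (by positivity)]
  refine le_of_mul_le_mul_left ?_ hn'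
  linarith

lemma achievable_converse
    {X Y B : Type} [Fintype X] [Fintype Y] [Fintype B]
    [Nonempty X] [DecidableEq Y] [DecidableEq B]
    (π : X → B) {Z : ℕ → Type} [∀ n, DecidableEq (Z n)]
    (f : ∀ n, (Fin n → X) → (Fin n → Y) → Z n)
    (hf : ∀ n, Cond1 π (f n))
    (p : ∀ n, (Fin n → X) → (Fin n → Y) → ℝ)
    (hp0 : ∀ n x y, 0 ≤ p n x y)
    (hp1 : ∀ n, ∑ x : (Fin n → X), ∑ y : (Fin n → Y), p n x y = 1)
    (q : ℝ) (hq0 : 0 < q) (hq1 : q < 1)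
    (hsmooth : ∀ n (x : Fin n → X) (y y' : Fin n → Y),
      hammingDist y y' = 1 → q * p n x y ≤ p n x y') (R : ℝ)
    (hR : Achievable p f R) (γ : ℝ) (hγ : 0 < γ) :
    Achievable (quotSource π p) (fun n (xb : Fin n → B) (_ : Fin n → Y) => xb) (R + 2 * γ) := by
  obtain ⟨hR0, M, φ, ψ, herr, hrate⟩ := hR
  haveI : Nonempty B := ⟨π (Classical.arbitrary X)⟩
  obtain ⟨t, δ, ht, hδ, hball⟩ := exists_params (Fintype.card B) γ hγ
  have hM : ∀ n, (1:ℝ) ≤ M n := by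
    intro n
    have : 0 < M n := Fin.pos (φ n (fun _ => Classical.arbitrary X))
    exact_mod_cast this
  let N : ℕ → ℕ := fun n => ⌈(M n : ℝ) * (2:ℝ) ^ (2 * γ * n)⌉₊
  have hpow : ∀ n : ℕ, (1:ℝ) ≤ (2:ℝ) ^ (2 * γ * n) := fun n =>
    Real.one_le_rpow (by norm_num) (by positivity)
  have hMp : ∀ n : ℕ, (1:ℝ) ≤ (M n : ℝ) * (2:ℝ) ^ (2 * γ * n) := fun n =>
    one_le_mul_of_one_le_of_one_le (hM n) (hpow n)
  have hN : ∀ n, 0 < N n := fun n => Nat.ceil_pos.2 (by linarith [hMp n])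
  have hN1 : ∀ n, (M n : ℝ) * (2:ℝ) ^ (2 * γ * n) ≤ N n := fun n => Nat.le_ceil _
  have hN2 : ∀ n, (N n : ℝ) ≤ 2 * ((M n : ℝ) * (2:ℝ) ^ (2 * γ * n)) := fun n => by
    have := Nat.ceil_lt_add_one (a := (M n : ℝ) * (2:ℝ) ^ (2 * γ * n)) (by linarith [hMp n])
    linarith [hMp n]
  choose φ' ψ' h' using fun n => converse_code π p hp0 hp1 q hq0 hq1 (hsmooth n) (f n) (hf n)
    (φ n) (ψ n) t δ ht hδ (N n) (hN n)
  refine ⟨by linarith, N, φ', ψ', ?_, ?_⟩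
  · have hlim : Tendsto (fun n : ℕ => Fintype.card Y / (q * δ) * errProb (p n) (f n) (φ n) (ψ n)
        + ((2:ℝ) ^ (-γ)) ^ n) atTop (nhds 0) := by
      have h1 := herr.const_mul (Fintype.card Y / (q * δ))
      have h2 : Tendsto (fun n : ℕ => ((2:ℝ) ^ (-γ)) ^ n) atTop (nhds 0) :=
        tendsto_pow_atTop_nhds_zero_of_lt_one (by positivity)
          (Real.rpow_lt_one_of_one_lt_of_neg (by norm_num) (by linarith))
      simpa using h1.add h2
    refine squeeze_zero' (Eventually.of_forall fun n =>
      errProb_nonneg _ (quot_nonneg π p hp0 n) _ _ _) ?_ hlim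
    filter_upwards [eventually_gt_atTop 0] with n hn
    refine (h' n hn).trans ?_
    gcongr
    have hNr : (0:ℝ) < N n := by exact_mod_cast hN n
    rw [div_le_iff₀ hNr]
    calc _ ≤ (M n : ℝ) * (2:ℝ) ^ (γ * n) := by
          gcongr
          exact hball n
      _ = ((2:ℝ) ^ (-γ)) ^ n * ((M n : ℝ) * (2:ℝ) ^ (2 * γ * n)) := by
          have : (2:ℝ) ^ (γ * n) = ((2:ℝ) ^ (-γ)) ^ n * (2:ℝ) ^ (2 * γ * n) := by
            rw [← Real.rpow_natCast, ← Real.rpow_mul (by norm_num),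
              ← Real.rpow_add (by norm_num)]
            congr 1; ring
          rw [this]; ring
      _ ≤ _ := by
          gcongr
          exact hN1 n
  · intro ε hε
    have h3 : Tendsto (fun n : ℕ => (1:ℝ) / n) atTop (nhds 0) := tendsto_one_div_atTop_nhds_zero_nat
    filter_upwards [hrate (ε / 2) (by linarith), h3.eventually (gt_mem_nhds (half_pos hε)),
      eventually_gt_atTop 0] with n h1 h2 hn
    have hn' : (0:ℝ) < n := by exact_mod_cast hn
    have hNr : (0:ℝ) < N n := by exact_mod_cast hN n
    have hM0 : (M n : ℝ) ≠ 0 := by linarith [hM n]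
    have hlog : Real.logb 2 (N n) ≤ 1 + (Real.logb 2 (M n) + 2 * γ * n) := by
      have := Real.logb_le_logb_of_le (b := 2) (by norm_num) hNr (hN2 n)
      rwa [Real.logb_mul (by norm_num) (by linarith [hMp n]),
        Real.logb_mul hM0 (by linarith [hpow n]), Real.logb_rpow (by norm_num) (by norm_num),
        Real.logb_self_eq_one (by norm_num)] at this
    calc _ ≤ (1 + (Real.logb 2 (M n) + 2 * γ * n)) / n := by gcongr
      _ = 1 / n + Real.logb 2 (M n) / n + 2 * γ := by field_simp; ring
      _ ≤ _ := by linarith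

theorem optimal_rate_informative_eq_SW_of_quotient
    {X Y B : Type} [Fintype X] [Fintype Y] [Fintype B]
    [Nonempty X] [Nonempty Y]
    [DecidableEq X] [DecidableEq Y] [DecidableEq B]
    (π : X → B) (hπ : Function.Surjective π)
    {Z : ℕ → Type} [∀ n, DecidableEq (Z n)]
    (f : ∀ n, (Fin n → X) → (Fin n → Y) → Z n)
    (hf : ∀ n, Cond1 π (f n) ∧ Cond2 π (f n))
    (p : ∀ n, (Fin n → X) → (Fin n → Y) → ℝ)
    (hp0 : ∀ n x y, 0 ≤ p n x y)
    (hp1 : ∀ n, ∑ x : (Fin n → X), ∑ y : (Fin n → Y), p n x y = 1)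
    (q : ℝ) (hq0 : 0 < q) (hq1 : q < 1)
    (hsmooth : ∀ n (x : Fin n → X) (y y' : Fin n → Y),
      hammingDist y y' = 1 → q * p n x y ≤ p n x y') :
    optRate p f
      = optRate (quotSource π p)
          (fun n (xb : Fin n → B) (_ : Fin n → Y) => xb) := by
  have hdir : {R | Achievable (quotSource π p) (fun n (xb : Fin n → B) (_ : Fin n → Y) => xb) R}
      ⊆ {R | Achievable p f R} := fun R hR =>
    achievable_direct π f (fun n => (hf n).2) p hp0 R hR
  have hconv : ∀ R, Achievable p f R → ∀ γ : ℝ, 0 < γ →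
      Achievable (quotSource π p) (fun n (xb : Fin n → B) (_ : Fin n → Y) => xb) (R + 2 * γ) :=
    fun R hR γ hγ =>
      achievable_converse π f (fun n => (hf n).1) p hp0 hp1 q hq0 hq1 hsmooth R hR γ hγ
  unfold optRate
  have hbf : BddBelow {R | Achievable p f R} := ⟨0, fun R hR => hR.1⟩
  have hbq := hbf.mono hdir
  rcases Set.eq_empty_or_nonempty {R | Achievable p f R} with he | ⟨R0, hR0⟩
  · have he2 := Set.subset_eq_empty hdir he
    rw [he, he2]
  · apply le_antisymm
    · exact csInf_le_csInf hbf ⟨_, hconv R0 hR0 1 one_pos⟩ hdir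
    · apply le_csInf ⟨R0, hR0⟩
      intro R hR
      apply le_of_forall_pos_le_add
      intro ε hε
      have := csInf_le hbq (hconv R hR (ε / 2) (half_pos hε))
      linarith

end Stmt0
end

section
/- Let P_{XY} be a probability distribution on 𝒳 × 𝒴 with support set S = supp(P_{XY}), whose 𝒳-marginal has full support, and let f : 𝒳 × 𝒴 → 𝒱 be a function. Let 𝒢 = (𝒳, ℰ) be the hypergraph whose hyperedge set ℰ = ℰ(S,f) is the set of all maximal solvable hyperedges for (S,f). Then, for the i.i.d. source (X,Y) with per-letter distribution P_{XY}, the optimal rate for computing the sequence of type functions f^t = {fₙ^t}ₙ satisfies R(X|Y|f^t) = H_𝒢(X|Y). -/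
/-!
STATEMENT 1: For an i.i.d. source with per-letter distribution `P_{XY}` (whose
X-marginal has full support) and a symbol-wise function `f : X × Y → V`, the
optimal rate for computing the type of the symbol-wise function equals the
conditional hypergraph entropy `H_𝒢(X|Y)`, where the hyperedge set of `𝒢` is the
set of all maximal solvable hyperedges for `(S, f)`, `S = supp(P_{XY})`.

Types of sequences are encoded by their count functions: the type of `s ∈ Vⁿ`
corresponds to `fun v => |{i : s i = v}|`.
-/

open Finset Filter

namespace Stmt1

/-- The type (as a count function) of a sequence `s ∈ Vⁿ`. -/
def typeOf {V : Type} [DecidableEq V] {n : ℕ} (s : Fin n → V) : V → ℕ :=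
  fun v => (Finset.univ.filter (fun i => s i = v)).card

/-- Error probability of a code `(φ, ψ)` for computing `f` under joint pmf `p`. -/
noncomputable def errProb {A Y Z : Type} [Fintype A] [Fintype Y] [DecidableEq Z]
    {n M : ℕ} (p : (Fin n → A) → (Fin n → Y) → ℝ)
    (f : (Fin n → A) → (Fin n → Y) → Z)
    (φ : (Fin n → A) → Fin M) (ψ : Fin M → (Fin n → Y) → Z) : ℝ :=
  ∑ x : Fin n → A, ∑ y : Fin n → Y, if ψ (φ x) y = f x y then 0 else p x y

/-- A rate `R ≥ 0` is achievable for computing the sequence of functions `f`. -/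
def Achievable {A Y : Type} [Fintype A] [Fintype Y]
    (p : ∀ n, (Fin n → A) → (Fin n → Y) → ℝ)
    {Z : ℕ → Type} [∀ n, DecidableEq (Z n)]
    (f : ∀ n, (Fin n → A) → (Fin n → Y) → Z n) (R : ℝ) : Prop :=
  0 ≤ R ∧
  ∃ M : ℕ → ℕ, ∃ φ : ∀ n, (Fin n → A) → Fin (M n),
    ∃ ψ : ∀ n, Fin (M n) → (Fin n → Y) → Z n,
      Tendsto (fun n => errProb (p n) (f n) (φ n) (ψ n)) atTop (nhds 0) ∧
      ∀ ε : ℝ, 0 < ε → ∀ᶠ n : ℕ in atTop, Real.logb 2 (M n) / n ≤ R + ε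

/-- The optimal rate: the infimum of achievable rates. -/
noncomputable def optRate {A Y : Type} [Fintype A] [Fintype Y]
    (p : ∀ n, (Fin n → A) → (Fin n → Y) → ℝ)
    {Z : ℕ → Type} [∀ n, DecidableEq (Z n)]
    (f : ∀ n, (Fin n → A) → (Fin n → Y) → Z n) : ℝ :=
  sInf {R | Achievable p f R}

/-- The balanced condition `|I₊(v)| = |I₋(v)|` for a simple loop
`(a i, b i), (a i, b (i+1)) (i ∈ ℤ/m)`. -/
def Balanced {X Y V : Type} (f : X → Y → V) {m : ℕ}
    (a : ZMod m → X) (b : ZMod m → Y) : Prop :=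
  ∀ v : V, {i : ZMod m | f (a i) (b i) = v}.ncard
    = {i : ZMod m | f (a i) (b (i + 1)) = v}.ncard

/-- `A × B` is solvable for `(S, f)`: every simple loop of `A × B` contained in `S`
is balanced.  A simple loop with `m ≥ 2` pairwise distinct rows `a i` and columns
`b i` consists of the pairs `(a i, b i)` and `(a i, b (i+1))`, `i ∈ ℤ/m`. -/
def Solvable {X Y V : Type} (S : Set (X × Y)) (f : X → Y → V)
    (A : Set X) (B : Set Y) : Prop :=
  ∀ (m : ℕ), 2 ≤ m → ∀ (a : ZMod m → X) (b : ZMod m → Y),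
    Function.Injective a → Function.Injective b →
    (∀ i, a i ∈ A) → (∀ i, b i ∈ B) →
    (∀ i, (a i, b i) ∈ S) → (∀ i, (a i, b (i + 1)) ∈ S) →
    Balanced f a b

/-- A hyperedge `e ⊆ X` is solvable if `e × 𝒴` is solvable for `(S, f)`. -/
def SolvableEdge {X Y V : Type} (S : Set (X × Y)) (f : X → Y → V)
    (e : Finset X) : Prop :=
  Solvable S f (↑e) Set.univ

/-- The set `ℰ(S,f)` of maximal solvable hyperedges. -/
def maxSolvableEdges {X Y V : Type} (S : Set (X × Y)) (f : X → Y → V) :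
    Set (Finset X) :=
  {e | SolvableEdge S f e ∧ ∀ e' : Finset X, SolvableEdge S f e' → e ⊆ e' → e' = e}

/-- The conditional mutual information `I(W ∧ X | Y)` (base-2), where the joint
distribution of `(W, X, Y)` is `P(w,x,y) = t(w|x) P_{XY}(x,y)` (so that
`W −∘− X −∘− Y` is a Markov chain with test channel `t`). -/
noncomputable def condMI {X Y : Type} [Fintype X] [Fintype Y]
    (P : X → Y → ℝ) (t : X → Finset X → ℝ) : ℝ :=
  ∑ w : Finset X, ∑ x : X, ∑ y : Y,
    t x w * P x y *
      Real.logb 2 ((t x w * P x y) * (∑ x' : X, P x' y)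
        / ((∑ x' : X, t x' w * P x' y) * P x y))

/-- The conditional hypergraph entropy `H_𝒢(X|Y)` with hyperedge set `E`:
the infimum of `I(W ∧ X|Y)` over test channels `t = P_{W|X}` taking values in `E`
with `Pr(X ∈ W) = 1`. -/
noncomputable def hypEnt {X Y : Type} [Fintype X] [Fintype Y]
    (P : X → Y → ℝ) (E : Set (Finset X)) : ℝ :=
  sInf {r | ∃ t : X → Finset X → ℝ,
    (∀ x w, 0 ≤ t x w) ∧ (∀ x, ∑ w : Finset X, t x w = 1) ∧
    (∀ x w, t x w ≠ 0 → w ∈ E ∧ x ∈ w) ∧ r = condMI P t}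


/-! ### product measures -/

lemma sum_prod_pi {ι α : Type} [Fintype ι] [DecidableEq ι] [Fintype α] (g : ι → α → ℝ) :
    ∑ z : ι → α, ∏ i, g i (z i) = ∏ i, ∑ a, g i a := by
  classical
  rw [Finset.prod_univ_sum]
  simp

lemma sum_pn_one {ι α : Type} [Fintype ι] [DecidableEq ι] [Fintype α] (q : α → ℝ)
    (hq : ∑ a, q a = 1) : ∑ z : ι → α, ∏ i, q (z i) = 1 := by
  rw [sum_prod_pi (fun _ => q)]
  simp [hq]

lemma pn_nonneg {ι α : Type} [Fintype ι] {q : α → ℝ} (hq : ∀ a, 0 ≤ q a) (z : ι → α) :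
    0 ≤ ∏ i, q (z i) := Finset.prod_nonneg (fun _ _ => hq _)

lemma resample {ι α : Type} [Fintype ι] [DecidableEq ι] [Fintype α] (q : α → ℝ)
    (hq : ∑ a, q a = 1) (i : ι) (F : (ι → α) → ℝ) :
    ∑ z : ι → α, (∏ j, q (z j)) * F z
      = ∑ c, q c * ∑ z : ι → α, (∏ j, q (z j)) * F (Function.update z i c) := by
  have h1 : ∑ z : ι → α, (∏ j, q (z j)) * F z
      = ∑ s : α × (ι → α), q s.1 * ((∏ j, q (s.2 j)) * F s.2) := by
    rw [Fintype.sum_prod_type]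
    simp only
    simp_rw [← Finset.mul_sum]
    rw [← Finset.sum_mul, hq, one_mul]
  rw [h1]
  simp_rw [Finset.mul_sum]
  rw [← Fintype.sum_prod_type (fun s : α × (ι → α) => q s.1 * ((∏ j, q (s.2 j)) *
    F (Function.update s.2 i s.1)))]
  let e : α × (ι → α) ≃ α × (ι → α) :=
    { toFun := fun s => (s.2 i, Function.update s.2 i s.1)
      invFun := fun s => (s.2 i, Function.update s.2 i s.1)
      left_inv := fun s => by ext <;> simp
      right_inv := fun s => by ext <;> simp }
  symm
  refine Fintype.sum_equiv e _ _ ?_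
  rintro ⟨c, z⟩
  simp only [e, Equiv.coe_fn_mk]
  have h2 : ∀ z : ι → α, ∏ j, q (z j) = q (z i) * ∏ j ∈ Finset.univ.erase i, q (z j) := by
    intro z
    rw [Finset.mul_prod_erase _ (fun j => q (z j)) (Finset.mem_univ i)]
  rw [h2 z, h2 (Function.update z i c)]
  have h3 : ∏ j ∈ Finset.univ.erase i, q (Function.update z i c j)
      = ∏ j ∈ Finset.univ.erase i, q (z j) := by
    refine Finset.prod_congr rfl ?_
    intro j hj
    rw [Function.update_of_ne (Finset.ne_of_mem_erase hj)]
  rw [h3]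
  simp
  ring

lemma sum_pair {ι X Y : Type} [Fintype ι] [DecidableEq ι] [Fintype X] [Fintype Y]
    (F : (ι → X) → (ι → Y) → ℝ) :
    ∑ x : ι → X, ∑ y : ι → Y, F x y
      = ∑ z : ι → X × Y, F (fun i => (z i).1) (fun i => (z i).2) := by
  rw [← Fintype.sum_prod_type (fun s : (ι → X) × (ι → Y) => F s.1 s.2)]
  symm
  exact Fintype.sum_equiv (Equiv.arrowProdEquivProdArrow ι (fun _ => X) (fun _ => Y)) _ _ (fun z => rfl)

lemma expect_coord {ι α : Type} [Fintype ι] [DecidableEq ι] [Fintype α] (q : α → ℝ)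
    (hq : ∑ a, q a = 1) (i : ι) (g : α → ℝ) :
    ∑ z : ι → α, (∏ j, q (z j)) * g (z i) = ∑ c, q c * g c := by
  rw [resample q hq i]
  refine Finset.sum_congr rfl fun c _ => ?_
  simp [← Finset.sum_mul, sum_pn_one q hq]

lemma second_moment {n : ℕ} {α : Type} [Fintype α] (q : α → ℝ)
    (hq : ∑ a, q a = 1) (h : α → ℝ) (hh : ∑ a, q a * h a = 0) :
    ∑ z : Fin n → α, (∏ j, q (z j)) * (∑ i, h (z i)) ^ 2 = n * ∑ a, q a * h a ^ 2 := by
  classical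
  have h1 : ∀ z : Fin n → α, (∏ j, q (z j)) * (∑ i, h (z i)) ^ 2
      = ∑ i, ∑ k, (∏ j, q (z j)) * (h (z i) * h (z k)) := by
    intro z
    rw [sq, Finset.sum_mul_sum, Finset.mul_sum]
    refine Finset.sum_congr rfl fun i _ => ?_
    rw [Finset.mul_sum]
  simp_rw [h1]
  rw [Finset.sum_comm]
  have h2 : ∀ i : Fin n, ∑ z : Fin n → α, ∑ k, (∏ j, q (z j)) * (h (z i) * h (z k))
      = ∑ a, q a * h a ^ 2 := by
    intro i
    rw [Finset.sum_comm, Finset.sum_eq_single i]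
    · rw [expect_coord q hq i (fun a => h a * h a)]
      simp [sq]
    · intro k _ hk
      rw [resample q hq k]
      have : ∀ c, q c * ∑ z : Fin n → α, (∏ j, q (z j)) *
          (h (Function.update z k c i) * h (Function.update z k c k))
          = q c * h c * ∑ z : Fin n → α, (∏ j, q (z j)) * h (z i) := by
        intro c
        rw [mul_assoc, Finset.mul_sum _ _ (h c)]
        congr 1
        refine Finset.sum_congr rfl fun z _ => ?_
        rw [Function.update_of_ne (Ne.symm hk), Function.update_self]
        ring
      simp_rw [this]
      rw [← Finset.sum_mul, hh, zero_mul]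
    · simp
  simp_rw [h2]
  simp

/-- weak law -/
lemma wlln {n : ℕ} {α : Type} [Fintype α] (q : α → ℝ) (hq0 : ∀ a, 0 ≤ q a)
    (hq : ∑ a, q a = 1) (g : α → ℝ) (δ : ℝ) (hδ : 0 < δ) (hn : 0 < n)
    (B : (Fin n → α) → Prop) [DecidablePred B]
    (hB : ∀ z, (∏ j, q (z j)) ≠ 0 → B z → n * δ ≤ |∑ i, g (z i) - n * ∑ a, q a * g a|) :
    ∑ z : Fin n → α, (if B z then ∏ j, q (z j) else 0)
      ≤ (∑ a, q a * (g a - ∑ a, q a * g a) ^ 2) / δ ^ 2 / n := by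
  set μ := ∑ a, q a * g a with hμ
  have h0 : ∑ a, q a * (g a - μ) = 0 := by
    simp_rw [mul_sub]
    rw [Finset.sum_sub_distrib, ← Finset.sum_mul, hq, ← hμ]; ring
  have h1 := second_moment (n := n) q hq (fun a => g a - μ) h0
  have hn' : (0:ℝ) < n := by exact_mod_cast hn
  rw [div_div, le_div_iff₀ (by positivity), Finset.sum_mul]
  have h2 : ∑ z : Fin n → α, (if B z then ∏ j, q (z j) else 0) * ((n*δ)^2)
      ≤ n * ∑ a, q a * (g a - μ) ^ 2 := by
    rw [← h1]
    refine Finset.sum_le_sum fun z _ => ?_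
    have hp := pn_nonneg hq0 z
    split_ifs with hb
    · by_cases hz : (∏ j, q (z j)) = 0
      · simp [hz]
      · refine mul_le_mul_of_nonneg_left ?_ hp
        have h3 : ∑ i, (g (z i) - μ) = ∑ i, g (z i) - n * μ := by
          rw [Finset.sum_sub_distrib]; simp
        rw [h3, ← sq_abs (∑ i, g (z i) - n * μ)]
        have := hB z hz hb
        gcongr
    · rw [zero_mul]; positivity
  have h4 : ∑ z : Fin n → α, (if B z then ∏ j, q (z j) else 0) * ((n*δ)^2)
      = (∑ z : Fin n → α, (if B z then ∏ j, q (z j) else 0) * (δ^2 * n)) * n := by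
    rw [Finset.sum_mul]
    refine Finset.sum_congr rfl fun z _ => ?_
    ring
  rw [h4, mul_comm] at h2
  exact le_of_mul_le_mul_left h2 hn'

lemma gibbs {α : Type} [Fintype α] (q ρ : α → ℝ) (hq0 : ∀ a, 0 ≤ q a) (hq : ∑ a, q a = 1)
    (hρ : ∀ a, q a ≠ 0 → 0 < ρ a) (h : ∑ a, q a / ρ a ≤ 1) :
    0 ≤ ∑ a, q a * Real.logb 2 (ρ a) := by
  have hl : 0 < Real.log 2 := Real.log_pos (by norm_num)
  have h1 : ∑ a, (q a - q a / ρ a) ≤ ∑ a, q a * Real.log (ρ a) := by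
    refine Finset.sum_le_sum fun a _ => ?_
    by_cases ha : q a = 0
    · simp [ha]
    · have := Real.one_sub_inv_le_log_of_pos (hρ a ha)
      have := mul_le_mul_of_nonneg_left this (hq0 a)
      rw [div_eq_mul_inv]; linarith
  rw [Finset.sum_sub_distrib, hq] at h1
  have : ∑ a, q a * Real.logb 2 (ρ a) = (∑ a, q a * Real.log (ρ a)) / Real.log 2 := by
    rw [Finset.sum_div]
    refine Finset.sum_congr rfl fun a _ => ?_
    rw [Real.logb, mul_div_assoc]
  rw [this]
  apply div_nonneg _ hl.le
  linarith


/-! ### potentials -/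

/-- bipartite graph of `S` -/
def bip {X Y : Type} (S : X → Y → Prop) : SimpleGraph (X ⊕ Y) where
  Adj p q := (∃ a b, S a b ∧ p = Sum.inl a ∧ q = Sum.inr b) ∨
    (∃ a b, S a b ∧ q = Sum.inl a ∧ p = Sum.inr b)
  symm := ⟨by
    rintro p q (⟨a, b, h, rfl, rfl⟩ | ⟨a, b, h, rfl, rfl⟩)
    · exact Or.inr ⟨a, b, h, rfl, rfl⟩
    · exact Or.inl ⟨a, b, h, rfl, rfl⟩⟩
  loopless := ⟨by
    rintro p (⟨a, b, h, rfl, h'⟩ | ⟨a, b, h, rfl, h'⟩) <;> simp at h'⟩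

/-- weight of an oriented edge -/
def dw {X Y : Type} (c : X → Y → ℤ) : X ⊕ Y → X ⊕ Y → ℤ
  | Sum.inl a, Sum.inr b => c a b
  | Sum.inr b, Sum.inl a => - c a b
  | _, _ => 0

lemma dw_symm {X Y : Type} (c : X → Y → ℤ) (p q : X ⊕ Y) : dw c q p = - dw c p q := by
  rcases p with p | p <;> rcases q with q | q <;> simp [dw]

/-- weight of a walk -/
def ww {X Y : Type} (c : X → Y → ℤ) {G : SimpleGraph (X ⊕ Y)} :
    ∀ {u v : X ⊕ Y}, G.Walk u v → ℤ
  | _, _, SimpleGraph.Walk.nil => 0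
  | u, _, SimpleGraph.Walk.cons (v := v) _ p => dw c u v + ww c p

lemma ww_append {X Y : Type} (c : X → Y → ℤ) {G : SimpleGraph (X ⊕ Y)}
    {u v w : X ⊕ Y} (p : G.Walk u v) (q : G.Walk v w) :
    ww c (p.append q) = ww c p + ww c q := by
  induction p with
  | nil => simp [ww]
  | cons h p ih => simp [ww, ih, add_assoc]

lemma ww_reverse {X Y : Type} (c : X → Y → ℤ) {G : SimpleGraph (X ⊕ Y)}
    {u v : X ⊕ Y} (p : G.Walk u v) : ww c p.reverse = - ww c p := by
  induction p with
  | nil => simp [ww]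
  | @cons a b _ h p ih => 
    simp [ww, ih, ww_append, dw_symm c a b]

lemma ww_eq_sum {X Y : Type} (c : X → Y → ℤ) {G : SimpleGraph (X ⊕ Y)}
    {u v : X ⊕ Y} (p : G.Walk u v) :
    ww c p = ∑ k ∈ Finset.range p.length, dw c (p.getVert k) (p.getVert (k+1)) := by
  induction p with
  | nil => simp [ww]
  | cons h p ih => 
    rw [SimpleGraph.Walk.length_cons, Finset.sum_range_succ', ww, ih]
    simp only [SimpleGraph.Walk.getVert_cons_succ, SimpleGraph.Walk.getVert_zero]
    rw [add_comm]

lemma ww_bypass {X Y : Type} [DecidableEq (X ⊕ Y)] (c : X → Y → ℤ) {G : SimpleGraph (X ⊕ Y)}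
    (H : ∀ (u v : X ⊕ Y) (p : G.Walk v u), p.IsPath → G.Adj u v → dw c u v + ww c p = 0)
    {u v : X ⊕ Y} (p : G.Walk u v) : ww c p = ww c p.bypass := by
  induction p with
  | nil => simp [ww, SimpleGraph.Walk.bypass]
  | @cons u' v' w' h p ih =>
    rw [SimpleGraph.Walk.bypass, ww, ih]
    split_ifs with hs
    · have h1 := ww_append c (p.bypass.takeUntil u' hs) (p.bypass.dropUntil u' hs)
      rw [SimpleGraph.Walk.take_spec] at h1
      rw [h1, ← add_assoc, H _ _ _ ((SimpleGraph.Walk.bypass_isPath p).takeUntil hs) h, zero_add]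
    · rw [ww]

lemma potential_of_paths {X Y : Type} (c : X → Y → ℤ) (S : X → Y → Prop)
    (H : ∀ (u v : X ⊕ Y) (p : (bip S).Walk v u), p.IsPath → (bip S).Adj u v →
      dw c u v + ww c p = 0) :
    ∃ (u : X → ℤ) (v : Y → ℤ), ∀ a b, S a b → c a b = u a + v b := by
  classical
  have hcl : ∀ (u : X ⊕ Y) (p : (bip S).Walk u u), ww c p = 0 := by
    intro u p
    rw [ww_bypass c H p]
    have := SimpleGraph.Walk.eq_nil_iff_nil.2 (SimpleGraph.Walk.isPath_iff_nil (p := p.bypass) |>.1 (SimpleGraph.Walk.bypass_isPath p))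
    rw [this]; simp [ww]
  have hr : ∀ v : X ⊕ Y, Nonempty ((bip S).Walk ((bip S).connectedComponentMk v).out v) := by
    intro v
    have : (bip S).Reachable ((bip S).connectedComponentMk v).out v := by
      rw [← SimpleGraph.ConnectedComponent.eq]
      exact Quot.out_eq _
    exact this
  let W : ∀ v, (bip S).Walk ((bip S).connectedComponentMk v).out v := fun v => (hr v).some
  refine ⟨fun a => - ww c (W (Sum.inl a)), fun b => ww c (W (Sum.inr b)), ?_⟩
  intro a b hab
  have hadj : (bip S).Adj (Sum.inl a) (Sum.inr b) := Or.inl ⟨a, b, hab, rfl, rfl⟩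
  have hroot : ((bip S).connectedComponentMk (Sum.inl a)) = (bip S).connectedComponentMk (Sum.inr b) :=
    SimpleGraph.ConnectedComponent.eq.2 hadj.reachable
  have key : ∀ r, (h : r = ((bip S).connectedComponentMk (Sum.inr b)).out) → ∀ p : (bip S).Walk r (Sum.inl a),
      ww c p + c a b = ww c (W (Sum.inr b)) := by
    rintro r rfl p
    have := hcl _ ((p.append (SimpleGraph.Walk.cons hadj SimpleGraph.Walk.nil)).append (W (Sum.inr b)).reverse)
    rw [ww_append, ww_append, ww_reverse] at this
    simp [ww, dw] at this
    linarith
  have := key _ (by rw [hroot]) (W (Sum.inl a))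
  linarith

lemma path_weight {X Y : Type} (c : X → Y → ℤ) (S : X → Y → Prop)
    (H : ∀ (m : ℕ), 2 ≤ m → ∀ (a : ZMod m → X) (b : ZMod m → Y),
      Function.Injective a → Function.Injective b →
      (∀ i, S (a i) (b i)) → (∀ i, S (a i) (b (i + 1))) →
      ∑ᶠ i, c (a i) (b i) = ∑ᶠ i, c (a i) (b (i + 1)))
    (a : X) (b : Y) (hab : S a b) (p : (bip S).Walk (Sum.inl a) (Sum.inr b)) (hp : p.IsPath) :
    ww c p = c a b := by
  let A : ℕ → X := fun k => Sum.elim id (fun _ => a) (p.getVert (2 * k))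
  let B : ℕ → Y := fun k => Sum.elim (fun _ => b) id (p.getVert (2 * k + 1))
  have hA : ∀ k, 2 * k ≤ p.length → p.getVert (2 * k) = Sum.inl (A k) := by
    intro k hk
    simp only [A]
    suffices ∃ x, p.getVert (2 * k) = Sum.inl x by
      obtain ⟨x, hx⟩ := this
      rw [hx]; rfl
    induction k with
    | zero => exact ⟨a, by simp⟩
    | succ k ih =>
      obtain ⟨x, hx⟩ := ih (by omega)
      have h1 := p.adj_getVert_succ (i := 2 * k) (by omega)
      have h2 := p.adj_getVert_succ (i := 2 * k + 1) (by omega)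
      rw [hx] at h1
      rcases h1 with ⟨a', b', _, h3, h4⟩ | ⟨a', b', _, h3, h4⟩
      · rw [h4] at h2
        rcases h2 with ⟨a', b', _, h5, h6⟩ | ⟨a', b', _, h5, h6⟩
        · simp at h5
        · exact ⟨a', h5⟩
      · simp at h4
  have hB : ∀ k, 2 * k + 1 ≤ p.length → p.getVert (2 * k + 1) = Sum.inr (B k) ∧ S (A k) (B k) := by
    intro k hk
    have h1 := p.adj_getVert_succ (i := 2 * k) (by omega)
    rw [hA k (by omega)] at h1
    rcases h1 with ⟨a', b', h2, h3, h4⟩ | ⟨a', b', _, h3, h4⟩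
    · have : B k = b' := by simp [B, h4]
      rw [this, h4]
      simp at h3
      rw [h3]; exact ⟨rfl, h2⟩
    · simp at h4
  have hC : ∀ k, 2 * k + 2 ≤ p.length → S (A (k + 1)) (B k) := by
    intro k hk
    have h1 := p.adj_getVert_succ (i := 2 * k + 1) (by omega)
    rw [(hB k (by omega)).1, show 2 * k + 1 + 1 = 2 * (k + 1) by ring, hA (k + 1) (by omega)] at h1
    rcases h1 with ⟨a', b', h2, h3, h4⟩ | ⟨a', b', h2, h3, h4⟩
    · simp at h3
    · simp at h3 h4
      rw [h3, h4]; exact h2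
  obtain ⟨m, hm⟩ : ∃ m, p.length = 2 * m + 1 := by
    rcases Nat.even_or_odd' p.length with ⟨m, hm | hm⟩
    · have h1 := hA m hm.ge
      rw [← hm, SimpleGraph.Walk.getVert_length] at h1
      simp at h1
    · exact ⟨m, hm⟩
  have hA0 : A 0 = a := by simp [A]
  have hBm : B m = b := by
    have h1 := (hB m hm.ge).1
    rw [← hm, SimpleGraph.Walk.getVert_length] at h1
    simpa using h1.symm
  have hsum : ∀ r, r ≤ m → ∑ k ∈ Finset.range (2 * r + 1), dw c (p.getVert k) (p.getVert (k+1))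
      = ∑ k ∈ Finset.range (r + 1), c (A k) (B k) - ∑ k ∈ Finset.range r, c (A (k + 1)) (B k) := by
    intro r
    induction r with
    | zero =>
      intro _
      have h1 := hA 0 (by omega)
      have h2 := (hB 0 (by omega)).1
      simp only [Nat.mul_zero, Nat.zero_add] at h1 h2
      simp only [Nat.mul_zero, Nat.zero_add, Finset.sum_range_one, Finset.sum_range_zero, h1, h2, dw]
      simp
    | succ r ih =>
      intro hr
      have h1 := hA (r + 1) (by omega)
      have h2 := (hB (r + 1) (by omega)).1
      have h3 := (hB r (by omega)).1
      rw [show 2 * (r + 1) + 1 = 2 * r + 1 + 1 + 1 by ring, Finset.sum_range_succ,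
        Finset.sum_range_succ, ih (by omega), Finset.sum_range_succ _ (r+1), Finset.sum_range_succ _ r,
        Finset.sum_range_succ _ r]
      rw [show 2 * r + 1 + 1 + 1 = 2 * (r + 1) + 1 by ring, show 2 * r + 1 + 1 = 2 * (r + 1) by ring,
        h1, h2, h3]
      simp only [dw]
      ring
  rw [ww_eq_sum, hm, hsum m le_rfl]
  rcases Nat.eq_zero_or_pos m with rfl | hmpos
  · simp [hA0, hBm]
  have hinj : ∀ i j, i ≤ p.length → j ≤ p.length → p.getVert i = p.getVert j → i = j := by
    intro i j hi hj h
    exact hp.getVert_injOn hi hj h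
  have H' : ∀ (a : Fin (m + 1) → X) (b : Fin (m + 1) → Y),
      Function.Injective a → Function.Injective b →
      (∀ i, S (a i) (b i)) → (∀ i, S (a i) (b (i + 1))) →
      ∑ᶠ i, c (a i) (b i) = ∑ᶠ i, c (a i) (b (i + 1)) := H (m + 1) (by omega)
  have key := H' (fun i : Fin (m + 1) => A i.val)
    (fun i : Fin (m + 1) => B ((i - 1 : Fin (m + 1))).val) ?_ ?_ ?_ ?_
  · rw [finsum_eq_sum_of_fintype, finsum_eq_sum_of_fintype] at key
    have e1 : ∑ i : Fin (m + 1), c (A i.val) (B ((i - 1 : Fin (m + 1))).val)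
        = ∑ i : Fin (m + 1), c (A i.val) (B i.val) := by
      refine key.trans ?_
      refine Finset.sum_congr rfl fun i _ => ?_
      have : (i + 1 - 1 : Fin (m + 1)) = i := add_sub_cancel_right i 1
      exact congrArg (fun j : Fin (m + 1) => c (A i.val) (B j.val)) this
    rw [Fin.sum_univ_succ] at e1
    have e2 : ∀ i : Fin m, (i.succ - 1 : Fin (m + 1)).val = i.val := by
      intro i
      have : (i.succ - 1 : Fin (m + 1)) = i.castSucc := by
        rw [sub_eq_iff_eq_add, Fin.coeSucc_eq_succ]
      rw [this]; rfl
    have e3 : (0 - 1 : Fin (m + 1)).val = m := by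
      simp
    simp only [e2, e3, Fin.val_zero, Fin.val_succ, hA0, hBm] at e1
    rw [Fin.sum_univ_eq_sum_range (fun k => c (A (k + 1)) (B k)) m,
      Fin.sum_univ_eq_sum_range (fun k => c (A k) (B k)) (m + 1)] at e1
    linarith
  · intro i j hij
    simp only at hij
    have h1 := hA i.val (by have := i.isLt; omega)
    have h2 := hA j.val (by have := j.isLt; omega)
    rw [hij, ← h2] at h1
    have := hinj _ _ (by have := i.isLt; omega) (by have := j.isLt; omega) h1
    exact Fin.ext (by omega)
  · intro i j hij
    simp only at hij
    have : (i - 1 : Fin (m + 1)) = j - 1 := by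
      generalize (i - 1 : Fin (m + 1)) = i at *
      generalize (j - 1 : Fin (m + 1)) = j at *
      have h1 := (hB i.val (by have := i.isLt; omega)).1
      have h2 := (hB j.val (by have := j.isLt; omega)).1
      rw [hij, ← h2] at h1
      have := hinj _ _ (by have := i.isLt; omega) (by have := j.isLt; omega) h1
      exact Fin.ext (by omega)
    exact sub_left_injective this
  · intro i
    refine Fin.cases ?_ ?_ i
    · have e3 : (0 - 1 : Fin (m + 1)).val = m := by simp
      simp only [e3, Fin.val_zero, hA0, hBm]; exact hab
    · intro i
      have : (i.succ - 1 : Fin (m + 1)) = i.castSucc := by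
        rw [sub_eq_iff_eq_add, Fin.coeSucc_eq_succ]
      simp only [this]
      exact hC i.val (by have := i.isLt; omega)
  · intro i
    have : (i + 1 - 1 : Fin (m + 1)) = i := add_sub_cancel_right i 1
    have h3 := (hB (i : Fin (m+1)).val (by have := (i : Fin (m+1)).isLt; omega)).2
    exact (congrArg (fun j : Fin (m + 1) => S (A (i : Fin (m+1)).val) (B j.val)) this).mpr h3

lemma exists_potential {X Y : Type} (c : X → Y → ℤ) (S : X → Y → Prop)
    (H : ∀ (m : ℕ), 2 ≤ m → ∀ (a : ZMod m → X) (b : ZMod m → Y),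
      Function.Injective a → Function.Injective b →
      (∀ i, S (a i) (b i)) → (∀ i, S (a i) (b (i + 1))) →
      ∑ᶠ i, c (a i) (b i) = ∑ᶠ i, c (a i) (b (i + 1))) :
    ∃ (u : X → ℤ) (v : Y → ℤ), ∀ a b, S a b → c a b = u a + v b := by
  apply potential_of_paths c S
  rintro u v p hp (⟨a, b, hab, rfl, rfl⟩ | ⟨a, b, hab, rfl, rfl⟩)
  · have := path_weight c S H a b hab p.reverse hp.reverse
    rw [ww_reverse] at this
    simp only [dw]; linarith
  · have := path_weight c S H a b hab p hp
    simp only [dw]; linarith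

lemma finsum_ind {m : ℕ} (hm : 2 ≤ m) (Q : ZMod m → Prop) [DecidablePred Q] :
    ∑ᶠ i, (if Q i then (1 : ℤ) else 0) = ({i | Q i}.ncard : ℤ) := by
  have : NeZero m := ⟨by omega⟩
  rw [finsum_eq_sum_of_fintype, Finset.sum_boole, Set.ncard_eq_toFinset_card']
  simp

/-- potentials on a solvable hyperedge -/
lemma solvable_potential {X Y V : Type} [DecidableEq V] (S : Set (X × Y)) (f : X → Y → V)
    (e : Finset X) (he : SolvableEdge S f e) :
    ∃ (u : X → V → ℤ) (g : Y → V → ℤ), ∀ a b, a ∈ e → (a, b) ∈ S → ∀ v,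
      (if f a b = v then (1 : ℤ) else 0) = u a v + g b v := by
  have : ∀ v : V, ∃ (u : X → ℤ) (g : Y → ℤ), ∀ a b, (a ∈ e ∧ (a, b) ∈ S) →
      (if f a b = v then (1 : ℤ) else 0) = u a + g b := by
    intro v
    refine exists_potential (fun a b => if f a b = v then (1 : ℤ) else 0)
      (fun a b => a ∈ e ∧ (a, b) ∈ S) ?_
    intro m hm a b ha hb h1 h2
    have := he m hm a b ha hb (fun i => (h1 i).1) (fun i => Set.mem_univ _)
      (fun i => (h1 i).2) (fun i => (h2 i).2) v
    rw [finsum_ind hm (fun i => f (a i) (b i) = v), finsum_ind hm (fun i => f (a i) (b (i+1)) = v)]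
    exact_mod_cast this
  choose u g h using this
  exact ⟨fun a v => u v a, fun b v => g v b, fun a b hae hab v => h v a b ⟨hae, hab⟩⟩


/-! ### converse -/

lemma upd_fst {n : ℕ} {X Y : Type} (z : Fin n → X × Y) (i : Fin n) (a : X) (b : Y) :
    (fun j => (Function.update z i (a, b) j).1) = Function.update (fun j => (z j).1) i a := by
  funext j
  by_cases h : j = i
  · subst h; simp
  · simp [h]

lemma upd_snd {n : ℕ} {X Y : Type} (z : Fin n → X × Y) (i : Fin n) (a : X) (b : Y) :
    (fun j => (Function.update z i (a, b) j).2) = Function.update (fun j => (z j).2) i b := by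
  funext j
  by_cases h : j = i
  · subst h; simp
  · simp [h]

/-- induced single-letter test channel -/
noncomputable def tt {X Y : Type} [Fintype X] [Fintype Y] [DecidableEq X] {n M : ℕ}
    (P : X → Y → ℝ) (φ : (Fin n → X) → Fin M) (W : Fin n → Fin M → (Fin n → Y) → Finset X)
    (i : Fin n) (a : X) (w : Finset X) : ℝ :=
  ∑ z : Fin n → X × Y, (∏ j, P (z j).1 (z j).2) *
    (if W i (φ (Function.update (fun j => (z j).1) i a)) (fun j => (z j).2) = w then 1 else 0)

/-- likelihood ratio -/
noncomputable def KK {X Y : Type} [Fintype X] [Fintype Y]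
    (P : X → Y → ℝ) (t : X → Finset X → ℝ) (w : Finset X) (x : X) (y : Y) : ℝ :=
  (t x w * P x y) * (∑ x' : X, P x' y) / ((∑ x' : X, t x' w * P x' y) * P x y)

section
variable {X Y : Type} [Fintype X] [Fintype Y] [DecidableEq X] [DecidableEq Y] {n M : ℕ}
    (P : X → Y → ℝ) (hP0 : ∀ x y, 0 ≤ P x y) (hP1 : ∑ x : X, ∑ y : Y, P x y = 1)
    (φ : (Fin n → X) → Fin M) (W : Fin n → Fin M → (Fin n → Y) → Finset X)
    (hW : ∀ i m y b, W i m (Function.update y i b) = W i m y)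

lemma tt_nonneg (hP0 : ∀ x y, 0 ≤ P x y) (i : Fin n) (a : X) (w : Finset X) :
    0 ≤ tt P φ W i a w := by
  refine Finset.sum_nonneg fun z _ => mul_nonneg (Finset.prod_nonneg fun j _ => hP0 _ _) ?_
  split_ifs <;> simp

lemma sum_q_one {P : X → Y → ℝ} (hP1 : ∑ x : X, ∑ y : Y, P x y = 1) :
    ∑ c : X × Y, P c.1 c.2 = 1 := by
  rw [Fintype.sum_prod_type]; exact hP1

lemma tt_sum (hP1 : ∑ x : X, ∑ y : Y, P x y = 1) (i : Fin n) (a : X) :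
    ∑ w, tt P φ W i a w = 1 := by
  unfold tt
  rw [Finset.sum_comm]
  simp_rw [← Finset.mul_sum]
  simp
  exact sum_pn_one (fun c : X × Y => P c.1 c.2) (sum_q_one hP1)

lemma tt_expect (i : Fin n) (a : X) (g : Finset X → ℝ) :
    ∑ z : Fin n → X × Y, (∏ j, P (z j).1 (z j).2) *
      g (W i (φ (Function.update (fun j => (z j).1) i a)) (fun j => (z j).2))
      = ∑ w, tt P φ W i a w * g w := by
  unfold tt
  simp_rw [Finset.sum_mul]
  rw [Finset.sum_comm]
  refine Finset.sum_congr rfl fun z _ => ?_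
  simp

lemma condMI_tt (hP1 : ∑ x : X, ∑ y : Y, P x y = 1)
    (hW : ∀ i m y b, W i m (Function.update y i b) = W i m y) (i : Fin n) :
    condMI P (tt P φ W i) = ∑ z : Fin n → X × Y, (∏ j, P (z j).1 (z j).2) *
      Real.logb 2 (KK P (tt P φ W i) (W i (φ fun j => (z j).1) (fun j => (z j).2)) (z i).1 (z i).2) := by
  rw [resample (fun c : X × Y => P c.1 c.2) (sum_q_one hP1) i (fun z => 
    Real.logb 2 (KK P (tt P φ W i) (W i (φ fun j => (z j).1) (fun j => (z j).2)) (z i).1 (z i).2))]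
  have : ∀ c : X × Y, P c.1 c.2 * ∑ z : Fin n → X × Y, (∏ j, P (z j).1 (z j).2) *
      Real.logb 2 (KK P (tt P φ W i) (W i (φ fun j => (Function.update z i c j).1)
        (fun j => (Function.update z i c j).2)) (Function.update z i c i).1 (Function.update z i c i).2)
      = P c.1 c.2 * ∑ w, tt P φ W i c.1 w * Real.logb 2 (KK P (tt P φ W i) w c.1 c.2) := by
    rintro ⟨a, b⟩
    congr 1
    rw [← tt_expect P φ W i a (fun w => Real.logb 2 (KK P (tt P φ W i) w a b))]
    refine Finset.sum_congr rfl fun z _ => ?_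
    rw [upd_fst, upd_snd, hW, Function.update_self]
  simp_rw [this]
  unfold condMI
  rw [Fintype.sum_prod_type, Finset.sum_comm]
  refine Finset.sum_congr rfl fun x _ => ?_
  rw [Finset.sum_comm]
  refine Finset.sum_congr rfl fun y _ => ?_
  rw [Finset.mul_sum]
  refine Finset.sum_congr rfl fun w _ => ?_
  rw [KK]
  ring

lemma tt_pos (hP0 : ∀ x y, 0 ≤ P x y) (i : Fin n) (z : Fin n → X × Y)
    (hz : (∏ j, P (z j).1 (z j).2) ≠ 0) :
    0 < tt P φ W i (z i).1 (W i (φ fun j => (z j).1) (fun j => (z j).2)) := by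
  have hp : 0 < ∏ j, P (z j).1 (z j).2 :=
    lt_of_le_of_ne (Finset.prod_nonneg fun j _ => hP0 _ _) (Ne.symm hz)
  refine lt_of_lt_of_le hp ?_
  unfold tt
  have h1 := Finset.single_le_sum (f := fun z' : Fin n → X × Y => (∏ j, P (z' j).1 (z' j).2) *
    (if W i (φ (Function.update (fun j => (z' j).1) i (z i).1)) (fun j => (z' j).2)
      = W i (φ fun j => (z j).1) (fun j => (z j).2) then 1 else 0)) (s := Finset.univ)
      (fun z' _ => mul_nonneg (Finset.prod_nonneg fun j _ => hP0 _ _) (by split_ifs <;> simp))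
      (Finset.mem_univ z)
  refine le_trans (le_of_eq ?_) h1
  simp

lemma KK_pos (hP0 : ∀ x y, 0 ≤ P x y) (t : X → Finset X → ℝ) (ht : ∀ x w, 0 ≤ t x w)
    (w : Finset X) (x : X) (y : Y) (h1 : 0 < t x w) (h2 : P x y ≠ 0) : 0 < KK P t w x y := by
  have hp : 0 < P x y := lt_of_le_of_ne (hP0 _ _) (Ne.symm h2)
  have h3 : 0 < ∑ x' : X, P x' y := lt_of_lt_of_le hp
    (Finset.single_le_sum (f := fun x' => P x' y) (fun x' _ => hP0 x' y) (Finset.mem_univ x))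
  have h4 : 0 < ∑ x' : X, t x' w * P x' y := lt_of_lt_of_le (mul_pos h1 hp)
    (Finset.single_le_sum (f := fun x' => t x' w * P x' y) (fun x' _ => mul_nonneg (ht _ _) (hP0 x' y))
      (Finset.mem_univ x))
  unfold KK
  positivity

/-- `P_Y(y) Q(x|w,y)` -/
noncomputable def QQ (t : X → Finset X → ℝ) (w : Finset X) (x : X) (y : Y) : ℝ :=
  (∑ x' : X, P x' y) * (t x w * P x y / (∑ x' : X, t x' w * P x' y))

lemma P_mul_KK (t : X → Finset X → ℝ) (w : Finset X) (x : X) (y : Y) :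
    P x y * KK P t w x y = QQ P t w x y := by
  unfold KK QQ
  by_cases h : P x y = 0
  · simp [h]
  · by_cases h' : (∑ x' : X, t x' w * P x' y) = 0
    · simp [h']
    · field_simp

lemma QQ_nonneg (hP0 : ∀ x y, 0 ≤ P x y) (t : X → Finset X → ℝ) (ht : ∀ x w, 0 ≤ t x w)
    (w : Finset X) (x : X) (y : Y) : 0 ≤ QQ P t w x y := by
  unfold QQ
  refine mul_nonneg (Finset.sum_nonneg fun x' _ => hP0 _ _) (div_nonneg (mul_nonneg (ht _ _) (hP0 _ _))
    (Finset.sum_nonneg fun x' _ => mul_nonneg (ht _ _) (hP0 _ _)))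

lemma QQ_sum (hP0 : ∀ x y, 0 ≤ P x y) (t : X → Finset X → ℝ)
    (w : Finset X) (y : Y) : ∑ x, QQ P t w x y ≤ ∑ x' : X, P x' y := by
  unfold QQ
  rw [← Finset.mul_sum, ← Finset.sum_div]
  exact mul_le_of_le_one_right (Finset.sum_nonneg fun x' _ => hP0 _ _) (div_self_le_one _)

lemma sum_ratio_le (hP0 : ∀ x y, 0 ≤ P x y) (hP1 : ∑ x : X, ∑ y : Y, P x y = 1)
    (t : Fin n → X → Finset X → ℝ) (ht : ∀ i x w, 0 ≤ t i x w) :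
    ∑ z : Fin n → X × Y, (∏ j, P (z j).1 (z j).2) *
      ∏ i, KK P (t i) (W i (φ fun j => (z j).1) (fun j => (z j).2)) (z i).1 (z i).2 ≤ M := by
  have h1 : ∀ z : Fin n → X × Y, (∏ j, P (z j).1 (z j).2) *
      ∏ i, KK P (t i) (W i (φ fun j => (z j).1) (fun j => (z j).2)) (z i).1 (z i).2
      = ∏ i, QQ P (t i) (W i (φ fun j => (z j).1) (fun j => (z j).2)) (z i).1 (z i).2 := by
    intro z
    rw [← Finset.prod_mul_distrib]
    refine Finset.prod_congr rfl fun i _ => P_mul_KK _ _ _ _ _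
  simp_rw [h1]
  rw [← sum_pair (fun (x : Fin n → X) (y : Fin n → Y) => ∏ i, QQ P (t i) (W i (φ x) y) (x i) (y i))]
  rw [Finset.sum_comm]
  have h2 : ∀ y : Fin n → Y, ∑ x : Fin n → X, ∏ i, QQ P (t i) (W i (φ x) y) (x i) (y i)
      ≤ M * ∏ i, ∑ x' : X, P x' (y i) := by
    intro y
    calc ∑ x : Fin n → X, ∏ i, QQ P (t i) (W i (φ x) y) (x i) (y i)
        ≤ ∑ x : Fin n → X, ∑ m : Fin M, ∏ i, QQ P (t i) (W i m y) (x i) (y i) := by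
          refine Finset.sum_le_sum fun x _ => ?_
          exact Finset.single_le_sum (f := fun m => ∏ i, QQ P (t i) (W i m y) (x i) (y i))
            (fun m _ => Finset.prod_nonneg fun i _ => QQ_nonneg P hP0 _ (ht i) _ _ _) (Finset.mem_univ (φ x))
      _ = ∑ m : Fin M, ∏ i, ∑ x, QQ P (t i) (W i m y) x (y i) := by
          rw [Finset.sum_comm]
          refine Finset.sum_congr rfl fun m _ => ?_
          exact sum_prod_pi (fun i x => QQ P (t i) (W i m y) x (y i))
      _ ≤ ∑ m : Fin M, ∏ i, ∑ x' : X, P x' (y i) := by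
          refine Finset.sum_le_sum fun m _ => Finset.prod_le_prod ?_ ?_
          · exact fun i _ => Finset.sum_nonneg fun x _ => QQ_nonneg P hP0 _ (ht i) _ _ _
          · exact fun i _ => QQ_sum P hP0 _ _ _
      _ = _ := by simp
  refine (Finset.sum_le_sum fun y _ => h2 y).trans ?_
  rw [← Finset.mul_sum, sum_pn_one (fun y => ∑ x', P x' y) (by rw [Finset.sum_comm]; exact hP1), mul_one]

lemma sum_condMI_le (hM : 0 < M) (hP0 : ∀ x y, 0 ≤ P x y) (hP1 : ∑ x : X, ∑ y : Y, P x y = 1)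
    (hW : ∀ i m y b, W i m (Function.update y i b) = W i m y) :
    ∑ i, condMI P (tt P φ W i) ≤ Real.logb 2 M := by
  have hM' : (0:ℝ) < M := by exact_mod_cast hM
  have hl : 0 < Real.log 2 := Real.log_pos (by norm_num)
  simp_rw [condMI_tt P φ W hP1 hW]
  rw [Finset.sum_comm]
  simp_rw [← Finset.mul_sum]
  set Z : (Fin n → X × Y) → ℝ := fun z => 
    ∏ i, KK P (tt P φ W i) (W i (φ fun j => (z j).1) (fun j => (z j).2)) (z i).1 (z i).2 with hZ
  have h1 : ∀ z : Fin n → X × Y, (∏ j, P (z j).1 (z j).2) * ∑ i,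
      Real.logb 2 (KK P (tt P φ W i) (W i (φ fun j => (z j).1) (fun j => (z j).2)) (z i).1 (z i).2)
      ≤ (∏ j, P (z j).1 (z j).2) * (Real.logb 2 M - 1 / Real.log 2)
        + (∏ j, P (z j).1 (z j).2) * Z z * (1 / (M * Real.log 2)) := by
    intro z
    have hp : 0 ≤ ∏ j, P (z j).1 (z j).2 := Finset.prod_nonneg fun j _ => hP0 _ _
    by_cases hz : (∏ j, P (z j).1 (z j).2) = 0
    · simp [hz]
    · rw [mul_assoc, ← mul_add]
      refine mul_le_mul_of_nonneg_left ?_ hp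
      have hpos : ∀ i, 0 < KK P (tt P φ W i) (W i (φ fun j => (z j).1) (fun j => (z j).2)) (z i).1 (z i).2 := by
        intro i
        refine KK_pos P hP0 _ (fun x w => tt_nonneg P φ W hP0 i x w) _ _ _ (tt_pos P φ W hP0 i z hz) ?_
        exact (Finset.prod_ne_zero_iff.1 hz) i (Finset.mem_univ i)
      have hZp : 0 < Z z := Finset.prod_pos fun i _ => hpos i
      have e1 : ∑ i, Real.logb 2 (KK P (tt P φ W i) (W i (φ fun j => (z j).1) (fun j => (z j).2)) (z i).1 (z i).2)
          = Real.log (Z z) / Real.log 2 := by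
        rw [hZ, Real.log_prod (fun i _ => (hpos i).ne'), Finset.sum_div]
        rfl
      rw [e1, Real.logb]
      have e2 := Real.log_le_sub_one_of_pos (div_pos hZp hM')
      rw [Real.log_div hZp.ne' hM'.ne'] at e2
      have e3 : Real.log (M:ℝ) / Real.log 2 - 1 / Real.log 2 + Z z * (1 / (M * Real.log 2))
          = (Real.log M - 1 + Z z / M) / Real.log 2 := by field_simp
      rw [e3]
      refine div_le_div_of_nonneg_right ?_ hl.le
      linarith
  refine (Finset.sum_le_sum fun z _ => h1 z).trans ?_
  rw [Finset.sum_add_distrib, ← Finset.sum_mul, ← Finset.sum_mul,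
    sum_pn_one (fun c : X × Y => P c.1 c.2) (sum_q_one hP1)]
  have h2 := sum_ratio_le P φ W hP0 hP1 (tt P φ W) (fun i x w => tt_nonneg P φ W hP0 i x w)
  have h3 := mul_le_mul_of_nonneg_right h2 (show 0 ≤ 1 / (M * Real.log 2) by positivity)
  have h4 : (M:ℝ) * (1 / (M * Real.log 2)) = 1 / Real.log 2 := by field_simp
  rw [h4] at h3
  linarith

end


/-! ### converse, continued -/

lemma typeOf_eq_sum {V : Type} [DecidableEq V] {n : ℕ} (s : Fin n → V) (v : V) :
    (typeOf s v : ℤ) = ∑ j, if s j = v then (1 : ℤ) else 0 := by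
  rw [typeOf, Finset.sum_boole]

section
variable {X Y V : Type} [Fintype X] [Fintype Y] [DecidableEq X] [DecidableEq Y]
    [DecidableEq V] [Fintype V] {n M : ℕ}

/-- local correctness at coordinate `i` -/
def good (P : X → Y → ℝ) (f : X → Y → V) (φ : (Fin n → X) → Fin M)
    (ψ : Fin M → (Fin n → Y) → (V → ℕ)) (i : Fin n) (x : Fin n → X) (y : Fin n → Y) : Prop :=
  ∀ b, P (x i) b ≠ 0 → ψ (φ x) (Function.update y i b)
    = typeOf (fun j => f (x j) (Function.update y i b j))

open Classical in
/-- the induced hyperedge -/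
noncomputable def edg (P : X → Y → ℝ) (f : X → Y → V) (φ : (Fin n → X) → Fin M)
    (ψ : Fin M → (Fin n → Y) → (V → ℕ)) (i : Fin n) (m : Fin M) (y : Fin n → Y) : Finset X :=
  Finset.univ.filter (fun a => ∃ x, φ x = m ∧ x i = a ∧ good P f φ ψ i x y)

lemma typeOf_upd (f : X → Y → V) (i : Fin n) (x : Fin n → X) (y : Fin n → Y) (v : V) :
    ∃ r : ℤ, ∀ b, (typeOf (fun j => f (x j) (Function.update y i b j)) v : ℤ)
      = r + if f (x i) b = v then 1 else 0 := by
  refine ⟨∑ j ∈ Finset.univ.erase i, if f (x j) (y j) = v then 1 else 0, fun b => ?_⟩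
  rw [typeOf_eq_sum, ← Finset.sum_erase_add _ _ (Finset.mem_univ i), Function.update_self]
  congr 1
  refine Finset.sum_congr rfl fun j hj => ?_
  rw [Function.update_of_ne (Finset.ne_of_mem_erase hj)]

lemma edg_solvable (P : X → Y → ℝ) (f : X → Y → V) (φ : (Fin n → X) → Fin M)
    (ψ : Fin M → (Fin n → Y) → (V → ℕ)) (i : Fin n) (m : Fin M) (y : Fin n → Y) :
    SolvableEdge {s : X × Y | P s.1 s.2 ≠ 0} f (edg P f φ ψ i m y) := by
  intro k hk a b _ _ ha _ h1 h2 v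
  have : NeZero k := ⟨by omega⟩
  have hx : ∀ l, ∃ r : ℤ, ∀ b', P (a l) b' ≠ 0 → (ψ m (Function.update y i b') v : ℤ)
      = r + if f (a l) b' = v then 1 else 0 := by
    intro l
    have := ha l
    simp only [edg, Finset.coe_filter, Finset.mem_univ, true_and, Set.mem_ofPred_eq] at this
    obtain ⟨x, hx1, hx2, hx3⟩ := this
    obtain ⟨r, hr⟩ := typeOf_upd f i x y v
    refine ⟨r, fun b' hb' => ?_⟩
    have h := hx3 b' (by rw [hx2]; exact hb')
    rw [hx1] at h
    rw [h, hr b', hx2]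
  choose r hr using hx
  have e1 : ∑ l, ((if f (a l) (b l) = v then (1:ℤ) else 0) - (if f (a l) (b (l+1)) = v then (1:ℤ) else 0))
      = ∑ l, ((ψ m (Function.update y i (b l)) v : ℤ) - (ψ m (Function.update y i (b (l+1))) v : ℤ)) := by
    refine Finset.sum_congr rfl fun l _ => ?_
    rw [hr l _ (h1 l), hr l _ (h2 l)]; ring
  have e2 : ∑ l, (ψ m (Function.update y i (b (l+1))) v : ℤ) = ∑ l, (ψ m (Function.update y i (b l)) v : ℤ) :=
    Equiv.sum_comp (Equiv.addRight (1 : ZMod k)) (fun l => (ψ m (Function.update y i (b l)) v : ℤ))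
  rw [Finset.sum_sub_distrib, Finset.sum_sub_distrib, e2, sub_self] at e1
  have f1 := finsum_ind hk (fun l => f (a l) (b l) = v)
  have f2 := finsum_ind hk (fun l => f (a l) (b (l+1)) = v)
  rw [finsum_eq_sum_of_fintype] at f1 f2
  rw [f1, f2] at e1
  have : ({l | f (a l) (b l) = v}.ncard : ℤ) = {l | f (a l) (b (l+1)) = v}.ncard := by linarith
  exact_mod_cast this

lemma exists_max_edge (S : Set (X × Y)) (f : X → Y → V) (e : Finset X) (he : SolvableEdge S f e) :
    ∃ e' ∈ maxSolvableEdges S f, e ⊆ e' := by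
  have hfin : {e : Finset X | SolvableEdge S f e}.Finite := Set.toFinite _
  obtain ⟨m, hm, hmax⟩ := hfin.exists_le_maximal (a := e) he
  refine ⟨m, ⟨hmax.prop, fun e' he' hle => ?_⟩, hm⟩
  exact le_antisymm (hmax.2 he' hle) hle

lemma single_solvable (S : Set (X × Y)) (f : X → Y → V) (a : X) : SolvableEdge S f {a} := by
  intro k hk a' b ha _ ha' _ _ _ v
  exfalso
  have : Fact (1 < k) := ⟨by omega⟩
  have h : a' 0 = a' 1 := by
    have h0 := ha' 0
    have h1 := ha' 1
    simp at h0 h1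
    rw [h0, h1]
  exact zero_ne_one (ha h)

open Classical in
/-- a maximal solvable hyperedge above `e` -/
noncomputable def mxE (S : Set (X × Y)) (f : X → Y → V) (e : Finset X) : Finset X :=
  if h : ∃ e' ∈ maxSolvableEdges S f, e ⊆ e' then h.choose else e

lemma mxE_spec (S : Set (X × Y)) (f : X → Y → V) (e : Finset X) (he : SolvableEdge S f e) :
    mxE S f e ∈ maxSolvableEdges S f ∧ e ⊆ mxE S f e := by
  have h := exists_max_edge S f e he
  rw [mxE, dif_pos h]
  exact h.choose_spec

/-- the hyperedge variable `W_i` -/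
noncomputable def WW (P : X → Y → ℝ) (f : X → Y → V) (φ : (Fin n → X) → Fin M)
    (ψ : Fin M → (Fin n → Y) → (V → ℕ)) (i : Fin n) (m : Fin M) (y : Fin n → Y) : Finset X :=
  mxE {s : X × Y | P s.1 s.2 ≠ 0} f (edg P f φ ψ i m y)

lemma WW_mem (P : X → Y → ℝ) (f : X → Y → V) (φ : (Fin n → X) → Fin M)
    (ψ : Fin M → (Fin n → Y) → (V → ℕ)) (i : Fin n) (m : Fin M) (y : Fin n → Y) :
    WW P f φ ψ i m y ∈ maxSolvableEdges {s : X × Y | P s.1 s.2 ≠ 0} f :=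
  (mxE_spec _ f _ (edg_solvable P f φ ψ i m y)).1

lemma WW_sub (P : X → Y → ℝ) (f : X → Y → V) (φ : (Fin n → X) → Fin M)
    (ψ : Fin M → (Fin n → Y) → (V → ℕ)) (i : Fin n) (m : Fin M) (y : Fin n → Y) :
    edg P f φ ψ i m y ⊆ WW P f φ ψ i m y :=
  (mxE_spec _ f _ (edg_solvable P f φ ψ i m y)).2

lemma edg_upd (P : X → Y → ℝ) (f : X → Y → V) (φ : (Fin n → X) → Fin M)
    (ψ : Fin M → (Fin n → Y) → (V → ℕ)) (i : Fin n) (m : Fin M) (y : Fin n → Y) (b : Y) :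
    edg P f φ ψ i m (Function.update y i b) = edg P f φ ψ i m y := by
  have hg : ∀ x, good P f φ ψ i x (Function.update y i b) ↔ good P f φ ψ i x y := by
    intro x
    simp only [good, Function.update_idem]
  classical
  ext a
  simp [edg, hg]

lemma WW_upd (P : X → Y → ℝ) (f : X → Y → V) (φ : (Fin n → X) → Fin M)
    (ψ : Fin M → (Fin n → Y) → (V → ℕ)) (i : Fin n) (m : Fin M) (y : Fin n → Y) (b : Y) :
    WW P f φ ψ i m (Function.update y i b) = WW P f φ ψ i m y := by
  unfold WW
  rw [edg_upd]

lemma tt_bound (P : X → Y → ℝ) (hP0 : ∀ x y, 0 ≤ P x y) (hP1 : ∑ x : X, ∑ y : Y, P x y = 1)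
    (f : X → Y → V) (φ : (Fin n → X) → Fin M)
    (ψ : Fin M → (Fin n → Y) → (V → ℕ)) (i : Fin n) (a : X) (w : Finset X) (haw : a ∉ w) :
    tt P φ (WW P f φ ψ) i a w ≤ errProb (fun (x : Fin n → X) (y : Fin n → Y) => ∏ i, P (x i) (y i))
      (fun (x : Fin n → X) (y : Fin n → Y) => typeOf (fun i => f (x i) (y i))) φ ψ * ∑ b, (P a b)⁻¹ := by
  set E : (Fin n → X × Y) → ℝ := fun z => if ψ (φ fun j => (z j).1) (fun j => (z j).2)
    = typeOf (fun j => f (z j).1 (z j).2) then 0 else 1 with hE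
  have hE0 : ∀ z, 0 ≤ E z := by intro z; simp only [hE]; split_ifs <;> simp
  have hpn : ∀ z : Fin n → X × Y, 0 ≤ ∏ j, P (z j).1 (z j).2 := fun z => Finset.prod_nonneg fun j _ => hP0 _ _
  have herr : errProb (fun (x : Fin n → X) (y : Fin n → Y) => ∏ i, P (x i) (y i))
      (fun (x : Fin n → X) (y : Fin n → Y) => typeOf (fun i => f (x i) (y i))) φ ψ
      = ∑ z : Fin n → X × Y, (∏ j, P (z j).1 (z j).2) * E z := by
    unfold errProb
    rw [sum_pair]
    refine Finset.sum_congr rfl fun z _ => ?_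
    simp only [hE]
    split_ifs <;> simp
  set ε := errProb (fun (x : Fin n → X) (y : Fin n → Y) => ∏ i, P (x i) (y i))
      (fun (x : Fin n → X) (y : Fin n → Y) => typeOf (fun i => f (x i) (y i))) φ ψ with hε
  have h1 : ∀ b, P a b ≠ 0 → ∑ z : Fin n → X × Y, (∏ j, P (z j).1 (z j).2) * E (Function.update z i (a, b))
      ≤ ε * (P a b)⁻¹ := by
    intro b hb
    have hpos : 0 < P a b := lt_of_le_of_ne (hP0 _ _) (Ne.symm hb)
    rw [← div_eq_mul_inv, le_div_iff₀ hpos, herr, resample (fun c : X × Y => P c.1 c.2) (sum_q_one hP1) i E,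
      mul_comm]
    exact Finset.single_le_sum (f := fun c : X × Y => P c.1 c.2 * ∑ z : Fin n → X × Y, (∏ j, P (z j).1 (z j).2)
      * E (Function.update z i c)) (fun c _ => mul_nonneg (hP0 _ _) (Finset.sum_nonneg fun z _ =>
        mul_nonneg (hpn z) (hE0 _))) (Finset.mem_univ (a, b))
  have h2 : ∀ z : Fin n → X × Y, (if WW P f φ ψ i (φ (Function.update (fun j => (z j).1) i a))
      (fun j => (z j).2) = w then (1:ℝ) else 0)
      ≤ ∑ b, if P a b ≠ 0 then E (Function.update z i (a, b)) else 0 := by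
    intro z
    have hnn : ∀ b, 0 ≤ if P a b ≠ 0 then E (Function.update z i (a, b)) else 0 := by
      intro b; split_ifs; exacts [hE0 _, le_rfl]
    split_ifs with hw
    · have hng : ¬ good P f φ ψ i (Function.update (fun j => (z j).1) i a) (fun j => (z j).2) := by
        intro hg
        apply haw
        rw [← hw]
        apply WW_sub
        simp only [edg, Finset.mem_filter, Finset.mem_univ, true_and]
        exact ⟨_, rfl, by simp, hg⟩
      unfold good at hng
      push Not at hng
      obtain ⟨b, hb, hne⟩ := hng
      rw [Function.update_self] at hb
      refine le_trans (le_of_eq ?_) (Finset.single_le_sum (fun b _ => hnn b) (Finset.mem_univ b))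
      rw [if_pos hb]
      simp only [hE]
      have e1 := upd_fst z i a b
      have e2 := upd_snd z i a b
      rw [e1, e2, if_neg]
      intro h
      apply hne
      rw [h]
      congr 1
      funext j
      rw [← e1, ← e2]
    · exact Finset.sum_nonneg fun b _ => hnn b
  calc tt P φ (WW P f φ ψ) i a w
      ≤ ∑ z : Fin n → X × Y, (∏ j, P (z j).1 (z j).2) *
        ∑ b, if P a b ≠ 0 then E (Function.update z i (a, b)) else 0 := by
        unfold tt
        refine Finset.sum_le_sum fun z _ => mul_le_mul_of_nonneg_left (h2 z) (hpn z)
    _ = ∑ b, if P a b ≠ 0 then ∑ z : Fin n → X × Y, (∏ j, P (z j).1 (z j).2) * E (Function.update z i (a, b)) else 0 := by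
        simp_rw [Finset.mul_sum]
        rw [Finset.sum_comm]
        refine Finset.sum_congr rfl fun b _ => ?_
        split_ifs <;> simp
    _ ≤ ∑ b, ε * (P a b)⁻¹ := by
        refine Finset.sum_le_sum fun b _ => ?_
        split_ifs with hb
        · exact h1 b hb
        · push Not at hb; simp [hb]
    _ = _ := by rw [Finset.mul_sum]

lemma tt_ne (P : X → Y → ℝ) (f : X → Y → V) (φ : (Fin n → X) → Fin M)
    (ψ : Fin M → (Fin n → Y) → (V → ℕ)) (i : Fin n) (a : X) (w : Finset X)
    (h : tt P φ (WW P f φ ψ) i a w ≠ 0) : w ∈ maxSolvableEdges {s : X × Y | P s.1 s.2 ≠ 0} f := by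
  by_contra hw
  apply h
  unfold tt
  refine Finset.sum_eq_zero fun z _ => ?_
  rw [if_neg, mul_zero]
  rintro rfl
  exact hw (WW_mem ..)

/-- single-letter consequence of a code -/
lemma converse_single (hn : 0 < n) [Nonempty X] (P : X → Y → ℝ) (hP0 : ∀ x y, 0 ≤ P x y)
    (hP1 : ∑ x : X, ∑ y : Y, P x y = 1)
    (f : X → Y → V) (φ : (Fin n → X) → Fin M) (ψ : Fin M → (Fin n → Y) → (V → ℕ)) :
    ∃ t : X → Finset X → ℝ, (∀ x w, 0 ≤ t x w) ∧ (∀ x, ∑ w, t x w = 1) ∧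
      (∀ x w, t x w ≠ 0 → w ∈ maxSolvableEdges {s : X × Y | P s.1 s.2 ≠ 0} f) ∧
      (∀ x w, x ∉ w → t x w ≤ errProb (fun (x : Fin n → X) (y : Fin n → Y) => ∏ i, P (x i) (y i))
      (fun (x : Fin n → X) (y : Fin n → Y) => typeOf (fun i => f (x i) (y i))) φ ψ * ∑ b, (P x b)⁻¹) ∧
      condMI P t ≤ Real.logb 2 M / n := by
  have hM : 0 < M := Fin.pos (φ (fun _ => Classical.arbitrary X))
  have h := sum_condMI_le P φ (WW P f φ ψ) hM hP0 hP1 (WW_upd P f φ ψ)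
  have hn' : (0:ℝ) < n := by exact_mod_cast hn
  obtain ⟨i, hi⟩ : ∃ i, condMI P (tt P φ (WW P f φ ψ) i) ≤ Real.logb 2 M / n := by
    by_contra hc
    push Not at hc
    have : NeZero n := ⟨hn.ne'⟩
    have h2 := Finset.sum_lt_sum_of_nonempty (s := Finset.univ) ⟨(0 : Fin n), Finset.mem_univ _⟩ (fun i _ => hc i)
    rw [Finset.sum_const, Finset.card_univ, Fintype.card_fin, nsmul_eq_mul, mul_div_cancel₀ _ hn'.ne'] at h2
    linarith
  exact ⟨_, tt_nonneg P φ _ hP0 i, tt_sum P φ _ hP1 i, tt_ne P f φ ψ i, tt_bound P hP0 hP1 f φ ψ i, hi⟩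

/-- continuous form of `condMI` -/
noncomputable def cMI (P : X → Y → ℝ) (t : X → Finset X → ℝ) : ℝ :=
  ∑ w : Finset X, ((∑ x : X, ∑ y : Y, (P x y * (t x w * Real.log (t x w)) +
    t x w * P x y * Real.log (∑ x', P x' y))) -
    ∑ y : Y, (∑ x', t x' w * P x' y) * Real.log (∑ x', t x' w * P x' y)) / Real.log 2

lemma cMI_continuous (P : X → Y → ℝ) : Continuous (cMI P) := by
  unfold cMI
  refine continuous_finsetSum _ fun w _ => Continuous.div_const (Continuous.sub ?_ ?_) _
  · refine continuous_finsetSum _ fun x _ => continuous_finsetSum _ fun y _ => Continuous.add ?_ ?_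
    · refine Continuous.mul continuous_const ?_
      exact Real.continuous_mul_log.comp (by fun_prop : Continuous fun t : X → Finset X → ℝ => t x w)
    · fun_prop
  · refine continuous_finsetSum _ fun y _ => ?_
    exact Real.continuous_mul_log.comp 
      (by fun_prop : Continuous fun t : X → Finset X → ℝ => ∑ x', t x' w * P x' y)

lemma condMI_eq_cMI (P : X → Y → ℝ) (hP0 : ∀ x y, 0 ≤ P x y) (t : X → Finset X → ℝ)
    (ht : ∀ x w, 0 ≤ t x w) : condMI P t = cMI P t := by
  unfold condMI cMI
  refine Finset.sum_congr rfl fun w _ => ?_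
  have h1 : ∀ x y, t x w * P x y * Real.logb 2 ((t x w * P x y) * (∑ x' : X, P x' y)
        / ((∑ x' : X, t x' w * P x' y) * P x y))
      = (P x y * (t x w * Real.log (t x w)) +
    t x w * P x y * Real.log (∑ x', P x' y) - t x w * P x y * Real.log (∑ x', t x' w * P x' y)) / Real.log 2 := by
    intro x y
    by_cases hp : P x y = 0
    · simp [hp]
    by_cases h0 : t x w = 0
    · simp [h0]
    have hp' : 0 < P x y := lt_of_le_of_ne (hP0 _ _) (Ne.symm hp)
    have h1 : 0 < t x w := lt_of_le_of_ne (ht _ _) (Ne.symm h0)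
    have h3 : 0 < ∑ x' : X, P x' y := lt_of_lt_of_le hp'
      (Finset.single_le_sum (f := fun x' => P x' y) (fun x' _ => hP0 x' y) (Finset.mem_univ x))
    have h4 : 0 < ∑ x' : X, t x' w * P x' y := lt_of_lt_of_le (mul_pos h1 hp')
      (Finset.single_le_sum (f := fun x' => t x' w * P x' y) (fun x' _ => mul_nonneg (ht _ _) (hP0 x' y))
      (Finset.mem_univ x))
    have e : (t x w * P x y) * (∑ x' : X, P x' y) / ((∑ x' : X, t x' w * P x' y) * P x y)
        = t x w * (∑ x' : X, P x' y) / (∑ x' : X, t x' w * P x' y) := by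
      field_simp
    rw [e, Real.logb, Real.log_div (by positivity) h4.ne', Real.log_mul h0 h3.ne']
    ring
  simp_rw [h1, ← Finset.sum_div]
  congr 1
  simp_rw [Finset.sum_sub_distrib]
  congr 1
  rw [Finset.sum_comm]
  refine Finset.sum_congr rfl fun y _ => ?_
  rw [Finset.sum_mul]

lemma condMI_nonneg (P : X → Y → ℝ) (hP0 : ∀ x y, 0 ≤ P x y) 
    (hP1 : ∑ x : X, ∑ y : Y, P x y = 1) (t : X → Finset X → ℝ)
    (ht : ∀ x w, 0 ≤ t x w) (ht1 : ∀ x, ∑ w, t x w = 1) : 0 ≤ condMI P t := by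
  have h := gibbs (fun s : Finset X × X × Y => t s.2.1 s.1 * P s.2.1 s.2.2)
    (fun s => KK P t s.1 s.2.1 s.2.2) (fun s => mul_nonneg (ht _ _) (hP0 _ _)) ?_ ?_ ?_
  · simp only [Fintype.sum_prod_type] at h
    exact h
  · simp only [Fintype.sum_prod_type]
    rw [Finset.sum_comm]
    simp_rw [← Finset.mul_sum]
    simp_rw [← Finset.sum_mul]
    simp only [ht1, one_mul, hP1]
  · rintro ⟨w, x, y⟩ hne
    simp only at hne
    exact KK_pos P hP0 t ht w x y (lt_of_le_of_ne (ht _ _) (Ne.symm (left_ne_zero_of_mul hne)))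
      (right_ne_zero_of_mul hne)
  · have h1 : ∀ s : Finset X × X × Y, t s.2.1 s.1 * P s.2.1 s.2.2 / KK P t s.1 s.2.1 s.2.2
        ≤ P s.2.1 s.2.2 * ((∑ x' : X, t x' s.1 * P x' s.2.2) / (∑ x' : X, P x' s.2.2)) := by
      rintro ⟨w, x, y⟩
      simp only
      have hnn : 0 ≤ P x y * ((∑ x' : X, t x' w * P x' y) / (∑ x' : X, P x' y)) :=
        mul_nonneg (hP0 _ _) (div_nonneg (Finset.sum_nonneg fun x' _ => mul_nonneg (ht _ _) (hP0 _ _))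
          (Finset.sum_nonneg fun x' _ => hP0 _ _))
      by_cases hp : P x y = 0
      · simp [hp]
      by_cases h0 : t x w = 0
      · simpa [h0] using hnn
      have hp' : 0 < P x y := lt_of_le_of_ne (hP0 _ _) (Ne.symm hp)
      have h1 : 0 < t x w := lt_of_le_of_ne (ht _ _) (Ne.symm h0)
      have h3 : 0 < ∑ x' : X, P x' y := lt_of_lt_of_le hp'
        (Finset.single_le_sum (f := fun x' => P x' y) (fun x' _ => hP0 x' y) (Finset.mem_univ x))
      have h4 : 0 < ∑ x' : X, t x' w * P x' y := lt_of_lt_of_le (mul_pos h1 hp')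
        (Finset.single_le_sum (f := fun x' => t x' w * P x' y) (fun x' _ => mul_nonneg (ht _ _) (hP0 x' y))
        (Finset.mem_univ x))
      unfold KK
      apply le_of_eq
      field_simp
    refine (Finset.sum_le_sum fun s _ => h1 s).trans ?_
    simp only [Fintype.sum_prod_type]
    have h2 : ∀ w : Finset X, ∑ x, ∑ y, P x y * ((∑ x' : X, t x' w * P x' y) / (∑ x' : X, P x' y))
        ≤ ∑ y, (∑ x' : X, t x' w * P x' y) := by
      intro w
      rw [Finset.sum_comm]
      refine Finset.sum_le_sum fun y _ => ?_
      rw [← Finset.sum_mul, mul_div_left_comm]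
      exact mul_le_of_le_one_right (Finset.sum_nonneg fun x' _ => mul_nonneg (ht _ _) (hP0 _ _)) (div_self_le_one _)
    refine (Finset.sum_le_sum fun w _ => h2 w).trans ?_
    apply le_of_eq
    rw [Finset.sum_comm, ← hP1, Finset.sum_comm (f := fun x y => P x y)]
    refine Finset.sum_congr rfl fun y _ => ?_
    rw [Finset.sum_comm]
    refine Finset.sum_congr rfl fun x _ => ?_
    rw [← Finset.sum_mul, ht1, one_mul]

lemma hypEnt_bdd (P : X → Y → ℝ) (hP0 : ∀ x y, 0 ≤ P x y) 
    (hP1 : ∑ x : X, ∑ y : Y, P x y = 1) (E : Set (Finset X)) :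
    BddBelow {r | ∃ t : X → Finset X → ℝ,
    (∀ x w, 0 ≤ t x w) ∧ (∀ x, ∑ w : Finset X, t x w = 1) ∧
    (∀ x w, t x w ≠ 0 → w ∈ E ∧ x ∈ w) ∧ r = condMI P t} := by
  refine ⟨0, ?_⟩
  rintro r ⟨t, h1, h2, _, rfl⟩
  exact condMI_nonneg P hP0 hP1 t h1 h2

lemma converse [Nonempty X] (P : X → Y → ℝ) (hP0 : ∀ x y, 0 ≤ P x y)
    (hP1 : ∑ x : X, ∑ y : Y, P x y = 1) (f : X → Y → V) (R : ℝ)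
    (hR : Achievable (fun n (x : Fin n → X) (y : Fin n → Y) => ∏ i, P (x i) (y i))
        (fun n (x : Fin n → X) (y : Fin n → Y) => typeOf (fun i => f (x i) (y i))) R) :
    hypEnt P (maxSolvableEdges {s : X × Y | P s.1 s.2 ≠ 0} f) ≤ R := by
  obtain ⟨_, M, φ, ψ, herr, hrate⟩ := hR
  have hs := fun n : ℕ => converse_single (n := n + 1) (Nat.succ_pos n) P hP0 hP1 f (φ (n + 1)) (ψ (n + 1))
  choose t ht0 ht1 htE htb hti using hs
  have hcpt : IsCompact (Set.pi Set.univ (fun _ : X => Set.pi Set.univ (fun _ : Finset X => Set.Icc (0:ℝ) 1))) :=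
    isCompact_univ_pi fun _ => isCompact_univ_pi fun _ => isCompact_Icc
  have hmem : ∀ n, t n ∈ (Set.pi Set.univ (fun _ : X => Set.pi Set.univ (fun _ : Finset X => Set.Icc (0:ℝ) 1))) := by
    intro n x _ w _
    refine ⟨ht0 n x w, ?_⟩
    rw [← ht1 n x]
    exact Finset.single_le_sum (fun w _ => ht0 n x w) (Finset.mem_univ w)
  obtain ⟨t', ht'mem, k, hk, hlim⟩ := hcpt.tendsto_subseq hmem
  have hpt : ∀ x w, Tendsto (fun n => t (k n) x w) atTop (nhds (t' x w)) := by
    intro x w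
    have := (tendsto_pi_nhds.1 hlim) x
    exact (tendsto_pi_nhds.1 this) w
  have h0 : ∀ x w, 0 ≤ t' x w := fun x w => ge_of_tendsto' (hpt x w) (fun n => ht0 _ x w)
  have h1 : ∀ x, ∑ w, t' x w = 1 := by
    intro x
    have : Tendsto (fun n => ∑ w, t (k n) x w) atTop (nhds (∑ w, t' x w)) :=
      tendsto_finsetSum _ fun w _ => hpt x w
    simp_rw [ht1] at this
    exact tendsto_nhds_unique this tendsto_const_nhds
  have hk' : Tendsto (fun n => k n + 1) atTop atTop :=
    (tendsto_add_atTop_nat 1).comp hk.tendsto_atTop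
  have h2 : ∀ x w, t' x w ≠ 0 → w ∈ maxSolvableEdges {s : X × Y | P s.1 s.2 ≠ 0} f ∧ x ∈ w := by
    intro x w hne
    constructor
    · by_contra hw
      apply hne
      have : ∀ n, t (k n) x w = 0 := by
        intro n
        by_contra h
        exact hw (htE _ x w h)
      have h3 := hpt x w
      simp_rw [this] at h3
      exact (tendsto_nhds_unique h3 tendsto_const_nhds)
    · by_contra hw
      apply hne
      refine le_antisymm ?_ (h0 x w)
      have h3 := (herr.comp hk').mul_const (∑ b, (P x b)⁻¹)
      rw [zero_mul] at h3
      exact le_of_tendsto_of_tendsto' (hpt x w) h3 (fun n => htb (k n) x w hw)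
  have h3 : hypEnt P (maxSolvableEdges {s : X × Y | P s.1 s.2 ≠ 0} f) ≤ condMI P t' :=
    csInf_le (hypEnt_bdd P hP0 hP1 _) ⟨t', h0, h1, h2, rfl⟩
  refine h3.trans ?_
  refine le_of_forall_pos_le_add fun ε hε => ?_
  have h4 : Tendsto (fun n => condMI P (t (k n))) atTop (nhds (condMI P t')) := by
    have := ((cMI_continuous P).tendsto t').comp hlim
    rw [condMI_eq_cMI P hP0 t' h0]
    refine this.congr fun n => ?_
    rw [condMI_eq_cMI P hP0 _ (ht0 (k n))]
    rfl
  refine le_of_tendsto h4 ?_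
  filter_upwards [hk'.eventually (hrate ε hε)] with n hn
  exact (hti (k n)).trans hn

end


/-! ### one-shot achievability -/

lemma exists_le_avg {α : Type} [Fintype α] (μ F : α → ℝ) (K : ℝ) (h0 : ∀ a, 0 ≤ μ a)
    (h1 : ∑ a, μ a = 1) (h : ∑ a, μ a * F a ≤ K) : ∃ a, F a ≤ K := by
  by_contra hc
  push Not at hc
  have : ∑ a, μ a * K < ∑ a, μ a * F a := by
    obtain ⟨a, _, ha⟩ : ∃ a ∈ Finset.univ, 0 < μ a := by
      by_contra hn
      push Not at hn
      have := Finset.sum_nonpos hn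
      rw [h1] at this
      linarith
    refine Finset.sum_lt_sum (fun a _ => mul_le_mul_of_nonneg_left (hc a).le (h0 a)) ⟨a, Finset.mem_univ a, ?_⟩
    exact mul_lt_mul_of_pos_left (hc a) ha
  rw [← Finset.sum_mul, h1, one_mul] at this
  linarith

lemma cover_ineq (K τ : ℝ) (h0 : 0 ≤ τ) (h1 : τ ≤ 1) :
    Real.exp (-(K * τ)) ≤ 1 - τ + Real.exp (-K) := by
  have h := convexOn_exp.2 (Set.mem_univ (-K)) (Set.mem_univ 0) h0 (sub_nonneg.2 h1) (by ring)
  simp only [smul_eq_mul, mul_zero, add_zero, Real.exp_zero, mul_one] at h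
  have e : τ * -K = -(K * τ) := by ring
  rw [e] at h
  have := mul_le_of_le_one_left (Real.exp_pos (-K)).le h1
  linarith

open Classical in
lemma one_shot {X Y W : Type} [Fintype X] [Fintype Y] [Fintype W]
    (p : X → Y → ℝ) (hp0 : ∀ x y, 0 ≤ p x y) (hp1 : ∑ x, ∑ y, p x y = 1)
    (T : X → W → ℝ) (hT0 : ∀ x w, 0 ≤ T x w) (hT1 : ∀ x, ∑ w, T x w = 1)
    (Q : W → ℝ) (hQ0 : ∀ w, 0 ≤ Q w) (hQ1 : ∑ w, Q w = 1)
    (G1 : W → X → Prop) (G2 : W → Y → Prop) (A D δ s : ℝ) (hA : 0 < A) (hs : 0 < s)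
    (hG1 : ∀ w x, G1 w x → T x w ≤ A * Q w)
    (hG2 : ∀ y, ∑ w, (if G2 w y then Q w else 0) ≤ D)
    (hδ : ∑ x, ∑ y, ∑ w, (if G1 w x ∧ G2 w y then 0 else p x y * T x w) ≤ δ)
    (L B : ℕ) (hL : 0 < L) (hB : 0 < B) :
    ∃ (bin : X → Fin B) (ω : X → W) (dec : Fin B → Y → W),
      ∑ x, ∑ y, (if G1 (ω x) x ∧ dec (bin x) y = ω x then 0 else p x y)
        ≤ δ + δ / s + Real.exp (-(L / A)) + s + L * D / B := by
  have : NeZero L := ⟨hL.ne'⟩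
  have hB' : (0:ℝ) < B := by exact_mod_cast hB
  set px : X → ℝ := fun x => ∑ y, p x y with hpx
  have hpx0 : ∀ x, 0 ≤ px x := fun x => Finset.sum_nonneg fun y _ => hp0 x y
  set β : X → W → ℝ := fun x w => ∑ y, if G2 w y then 0 else p x y with hβ
  obtain ⟨G', hG'⟩ : ∃ G' : W → X → Prop, ∀ w x, G' w x ↔ (G1 w x ∧ β x w ≤ s * px x) :=
    ⟨_, fun _ _ => Iff.rfl⟩
  set τ : X → ℝ := fun x => ∑ w, if G' w x then T x w else 0 with hτ
  have hτ0 : ∀ x, 0 ≤ τ x := fun x => Finset.sum_nonneg fun w _ => by split_ifs; exacts [hT0 x w, le_rfl]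
  have hτ1 : ∀ x, τ x ≤ 1 := by
    intro x
    rw [← hT1 x]
    refine Finset.sum_le_sum fun w _ => ?_
    split_ifs; exacts [le_rfl, hT0 x w]
  -- (a)
  have ha : ∑ x, px x * (1 - τ x) ≤ δ + δ / s := by
    have h1 : ∀ x, px x * (1 - τ x) ≤ (1 + 1 / s) *
        ∑ y, ∑ w, (if G1 w x ∧ G2 w y then 0 else p x y * T x w) := by
      intro x
      have e : 1 - τ x = ∑ w, if G' w x then 0 else T x w := by
        rw [← hT1 x, hτ, ← Finset.sum_sub_distrib]
        refine Finset.sum_congr rfl fun w _ => ?_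
        split_ifs <;> simp
      rw [e, Finset.sum_comm, Finset.mul_sum, Finset.mul_sum]
      refine Finset.sum_le_sum fun w _ => ?_
      have hs1 : 0 < 1 / s := by positivity
      have hnn : 0 ≤ ∑ y, (if G1 w x ∧ G2 w y then 0 else p x y * T x w) :=
        Finset.sum_nonneg fun y _ => by split_ifs; exacts [le_rfl, mul_nonneg (hp0 _ _) (hT0 _ _)]
      split_ifs with hg
      · rw [mul_zero]; positivity
      · by_cases hg1 : G1 w x
        · have hb : s * px x < β x w := by
            by_contra hb
            exact hg ((hG' _ _).2 ⟨hg1, not_lt.1 hb⟩)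
          have e2 : ∑ y, (if G1 w x ∧ G2 w y then 0 else p x y * T x w) = β x w * T x w := by
            rw [hβ, Finset.sum_mul]
            refine Finset.sum_congr rfl fun y _ => ?_
            by_cases h2 : G2 w y <;> simp [hg1, h2]
          rw [e2] at hnn ⊢
          have e3 : px x ≤ 1 / s * β x w := by
            rw [div_mul_eq_mul_div, one_mul, le_div_iff₀ hs]; linarith
          have := mul_le_mul_of_nonneg_right e3 (hT0 x w)
          nlinarith
        · have e2 : ∑ y, (if G1 w x ∧ G2 w y then 0 else p x y * T x w) = px x * T x w := by
            rw [hpx, Finset.sum_mul]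
            refine Finset.sum_congr rfl fun y _ => ?_
            simp [hg1]
          rw [e2] at hnn ⊢
          nlinarith
    refine (Finset.sum_le_sum fun x _ => h1 x).trans ?_
    rw [← Finset.mul_sum]
    have : δ + δ / s = (1 + 1 / s) * δ := by ring
    rw [this]
    exact mul_le_mul_of_nonneg_left hδ (by positivity)
  -- (b)
  have hb : ∀ x, ∑ c : Fin L → W, (∏ l, Q (c l)) * (if ∀ l, ¬ G' (c l) x then 1 else 0)
      ≤ 1 - τ x + Real.exp (-(L / A)) := by
    intro x
    have e1 : ∀ c : Fin L → W, (∏ l, Q (c l)) * (if ∀ l, ¬ G' (c l) x then (1:ℝ) else 0)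
        = ∏ l, (if G' (c l) x then 0 else Q (c l)) := by
      intro c
      split_ifs with h
      · rw [mul_one]
        refine Finset.prod_congr rfl fun l _ => ?_
        rw [if_neg (h l)]
      · push Not at h
        obtain ⟨l, hl⟩ := h
        rw [mul_zero]
        symm
        refine Finset.prod_eq_zero (Finset.mem_univ l) ?_
        rw [if_pos hl]
    simp_rw [e1]
    rw [sum_prod_pi (fun _ w => if G' w x then 0 else Q w), Finset.prod_const, Finset.card_univ, Fintype.card_fin]
    have e2 : ∑ w, (if G' w x then 0 else Q w) ≤ 1 - τ x / A := by
      rw [← hQ1, hτ, Finset.sum_div, ← Finset.sum_sub_distrib]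
      refine Finset.sum_le_sum fun w _ => ?_
      split_ifs with h
      · rw [sub_nonneg, div_le_iff₀ hA]
        linarith [hG1 w x ((hG' w x).1 h).1]
      · simp
    have e3 : 0 ≤ ∑ w, (if G' w x then 0 else Q w) :=
      Finset.sum_nonneg fun w _ => by split_ifs; exacts [le_rfl, hQ0 w]
    have e4 : ∑ w, (if G' w x then 0 else Q w) ≤ Real.exp (-(τ x / A)) :=
      e2.trans (Real.one_sub_le_exp_neg _)
    refine (pow_le_pow_left₀ e3 e4 L).trans ?_
    rw [← Real.exp_nat_mul]
    have := cover_ineq (L / A) (τ x) (hτ0 x) (hτ1 x)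
    refine le_trans (le_of_eq ?_) this
    congr 1
    ring
  -- (c)
  have hc : ∀ y, ∑ c : Fin L → W, (∏ l, Q (c l)) * (∑ l, if G2 (c l) y then 1 else 0) ≤ L * D := by
    intro y
    simp_rw [Finset.mul_sum]
    rw [Finset.sum_comm]
    have : ∀ l : Fin L, ∑ c : Fin L → W, (∏ l, Q (c l)) * (if G2 (c l) y then 1 else 0) ≤ D := by
      intro l
      rw [expect_coord Q hQ1 l (fun w => if G2 w y then 1 else 0)]
      refine le_trans (le_of_eq ?_) (hG2 y)
      refine Finset.sum_congr rfl fun w _ => ?_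
      split_ifs <;> simp
    refine (Finset.sum_le_sum fun l _ => this l).trans ?_
    simp
  -- choose the codebook
  obtain ⟨c, hcc⟩ := exists_le_avg (fun c : Fin L → W => ∏ l, Q (c l))
    (fun c => ∑ x, px x * (if ∀ l, ¬ G' (c l) x then 1 else 0)
      + 1 / B * ∑ x, ∑ y, p x y * (∑ l, if G2 (c l) y then 1 else 0))
    (δ + δ / s + Real.exp (-(L / A)) + L * D / B) (fun c => pn_nonneg hQ0 c) (sum_pn_one Q hQ1) (by
      simp_rw [mul_add]
      rw [Finset.sum_add_distrib]
      have i1 : ∑ c : Fin L → W, (∏ l, Q (c l)) * ∑ x, px x * (if ∀ l, ¬ G' (c l) x then 1 else 0)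
          ≤ δ + δ / s + Real.exp (-(L / A)) := by
        have e1 : ∑ c : Fin L → W, (∏ l, Q (c l)) * ∑ x, px x * (if ∀ l, ¬ G' (c l) x then 1 else 0)
            = ∑ x, px x * ∑ c : Fin L → W, (∏ l, Q (c l)) * (if ∀ l, ¬ G' (c l) x then 1 else 0) := by
          simp_rw [Finset.mul_sum]
          rw [Finset.sum_comm]
          refine Finset.sum_congr rfl fun x _ => Finset.sum_congr rfl fun c _ => ?_
          ring
        rw [e1]
        refine (Finset.sum_le_sum fun x _ => mul_le_mul_of_nonneg_left (hb x) (hpx0 x)).trans ?_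
        simp_rw [mul_add]
        rw [Finset.sum_add_distrib, ← Finset.sum_mul]
        have : ∑ x, px x = 1 := hp1
        rw [this]
        linarith
      have i2 : ∑ c : Fin L → W, (∏ l, Q (c l)) * (1 / B * ∑ x, ∑ y, p x y * (∑ l, if G2 (c l) y then 1 else 0))
          ≤ L * D / B := by
        have e1 : ∑ c : Fin L → W, (∏ l, Q (c l)) * (1 / B * ∑ x, ∑ y, p x y * (∑ l, if G2 (c l) y then 1 else 0))
            = 1 / B * ∑ x, ∑ y, p x y * ∑ c : Fin L → W, (∏ l, Q (c l)) * (∑ l, if G2 (c l) y then 1 else 0) := by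
          simp_rw [Finset.mul_sum (s := (Finset.univ : Finset X)), Finset.mul_sum (s := (Finset.univ : Finset Y)),
            Finset.mul_sum (s := (Finset.univ : Finset (Fin L → W)))]
          rw [Finset.sum_comm]
          refine Finset.sum_congr rfl fun x _ => ?_
          rw [Finset.sum_comm]
          refine Finset.sum_congr rfl fun y _ => Finset.sum_congr rfl fun c _ => ?_
          ring
        rw [e1]
        have e2 : ∑ x, ∑ y, p x y * ∑ c : Fin L → W, (∏ l, Q (c l)) * (∑ l, if G2 (c l) y then 1 else 0)
            ≤ ∑ x, ∑ y, p x y * (L * D) :=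
          Finset.sum_le_sum fun x _ => Finset.sum_le_sum fun y _ => mul_le_mul_of_nonneg_left (hc y) (hp0 x y)
        simp_rw [← Finset.sum_mul] at e2
        rw [hp1, one_mul] at e2
        have := mul_le_mul_of_nonneg_left e2 (show 0 ≤ 1 / (B:ℝ) by positivity)
        refine this.trans (le_of_eq ?_)
        ring
      linarith)
  let ℓ : X → Fin L := fun x => if h : ∃ l, G' (c l) x then h.choose else 0
  have hℓ : ∀ x, ¬ (∀ l, ¬ G' (c l) x) → G' (c (ℓ x)) x := by
    intro x hx
    push Not at hx
    simp only [ℓ]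
    rw [dif_pos hx]
    exact hx.choose_spec
  -- choose the bins
  have hu : ∑ b : Fin B, (1 / B : ℝ) = 1 := by
    simp [hB'.ne']
  have hcol : ∀ l l' : Fin L, l ≠ l' → ∑ b : Fin L → Fin B, (∏ k : Fin L, (fun _ : Fin B => (1 / B : ℝ)) (b k)) *
      (if b l = b l' then 1 else 0) = 1 / B := by
    intro l l' hne
    rw [resample (fun _ : Fin B => (1 / B : ℝ)) hu l (fun b => if b l = b l' then 1 else 0)]
    simp_rw [Function.update_self, Function.update_of_ne hne.symm]
    rw [← Finset.mul_sum, Finset.sum_comm]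
    have : ∀ b : Fin L → Fin B, ∑ c : Fin B, (∏ k : Fin L, (1 / B : ℝ)) * (if c = b l' then 1 else 0)
        = ∏ k : Fin L, (fun _ : Fin B => (1 / B : ℝ)) (b k) := by
      intro b; simp
    simp_rw [this]
    rw [sum_pn_one _ hu, mul_one]
  obtain ⟨b, hbb⟩ := exists_le_avg (fun b : Fin L → Fin B => ∏ k : Fin L, (fun _ : Fin B => (1 / B : ℝ)) (b k))
    (fun b => ∑ x, ∑ y, p x y * ∑ l, (if l ≠ ℓ x ∧ b l = b (ℓ x) ∧ G2 (c l) y then 1 else 0))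
    (1 / B * ∑ x, ∑ y, p x y * (∑ l, if G2 (c l) y then 1 else 0))
    (fun b => pn_nonneg (fun _ => one_div_nonneg.2 hB'.le) b) (sum_pn_one _ hu) (by
      simp_rw [Finset.mul_sum (s := (Finset.univ : Finset X)), Finset.mul_sum (s := (Finset.univ : Finset Y)),
        Finset.mul_sum (s := (Finset.univ : Finset (Fin L)))]
      rw [Finset.sum_comm]
      refine Finset.sum_le_sum fun x _ => ?_
      rw [Finset.sum_comm]
      refine Finset.sum_le_sum fun y _ => ?_
      rw [Finset.sum_comm]
      refine Finset.sum_le_sum fun l _ => ?_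
      have hp := hp0 x y
      by_cases h1 : l ≠ ℓ x ∧ G2 (c l) y
      · have := hcol l (ℓ x) h1.1
        rw [if_pos h1.2]
        have e : ∀ b : Fin L → Fin B, (∏ k : Fin L, (fun _ : Fin B => (1 / B : ℝ)) (b k)) * (p x y *
            (if l ≠ ℓ x ∧ b l = b (ℓ x) ∧ G2 (c l) y then 1 else 0))
            = p x y * ((∏ k : Fin L, (fun _ : Fin B => (1 / B : ℝ)) (b k)) * (if b l = b (ℓ x) then 1 else 0)) := by
          intro b
          simp only [h1.1, h1.2, ne_eq, not_false_eq_true, true_and, and_true]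
          ring
        simp_rw [e]
        rw [← Finset.mul_sum, this]
        apply le_of_eq; ring
      · have e : ∀ b : Fin L → Fin B, (if l ≠ ℓ x ∧ b l = b (ℓ x) ∧ G2 (c l) y then (1:ℝ) else 0) = 0 := by
          intro b
          rw [if_neg]
          rintro ⟨h2, _, h3⟩
          exact h1 ⟨h2, h3⟩
        simp_rw [e]
        simp only [mul_zero, Finset.sum_const_zero]
        exact mul_nonneg (one_div_nonneg.2 hB'.le) (mul_nonneg hp (by split_ifs <;> norm_num)))
  refine ⟨fun x => b (ℓ x), fun x => c (ℓ x),
    fun m y => if h : ∃ l, b l = m ∧ G2 (c l) y then c h.choose else c 0, ?_⟩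
  have hmain : ∀ x y, (if G1 (c (ℓ x)) x ∧ (if h : ∃ l, b l = b (ℓ x) ∧ G2 (c l) y then c h.choose else c 0) = c (ℓ x)
      then 0 else p x y) ≤ p x y * (if ∀ l, ¬ G' (c l) x then 1 else 0)
        + (if ∀ l, ¬ G' (c l) x then 0 else if G2 (c (ℓ x)) y then 0 else p x y)
        + p x y * ∑ l, (if l ≠ ℓ x ∧ b l = b (ℓ x) ∧ G2 (c l) y then 1 else 0) := by
    intro x y
    have hp := hp0 x y
    have hn1 : 0 ≤ p x y * (if ∀ l, ¬ G' (c l) x then 1 else 0) := by split_ifs <;> simp [hp]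
    have hn2 : 0 ≤ (if ∀ l, ¬ G' (c l) x then 0 else if G2 (c (ℓ x)) y then 0 else p x y) := by
      split_ifs <;> simp [hp]
    have hn3 : ∀ l, (0:ℝ) ≤ (if l ≠ ℓ x ∧ b l = b (ℓ x) ∧ G2 (c l) y then 1 else 0) := by
      intro l; split_ifs <;> simp
    have hn4 : 0 ≤ p x y * ∑ l, (if l ≠ ℓ x ∧ b l = b (ℓ x) ∧ G2 (c l) y then 1 else 0) :=
      mul_nonneg hp (Finset.sum_nonneg fun l _ => hn3 l)
    by_cases hok : G1 (c (ℓ x)) x ∧ (if h : ∃ l, b l = b (ℓ x) ∧ G2 (c l) y then c h.choose else c 0) = c (ℓ x)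
    · rw [if_pos hok]; linarith
    · rw [if_neg hok]
      by_cases hf : ∀ l, ¬ G' (c l) x
      · rw [if_pos hf, if_pos hf]
        linarith
      · rw [if_neg hf, if_neg hf]
        by_cases hg : G2 (c (ℓ x)) y
        · have hex : ∃ l, b l = b (ℓ x) ∧ G2 (c l) y := ⟨ℓ x, rfl, hg⟩
          rw [dif_pos hex] at hok
          have hne : hex.choose ≠ ℓ x := by
            intro h
            exact hok ⟨((hG' _ _).1 (hℓ x hf)).1, by rw [h]⟩
          have h1 : (1:ℝ) ≤ ∑ l, (if l ≠ ℓ x ∧ b l = b (ℓ x) ∧ G2 (c l) y then (1:ℝ) else 0) := by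
            refine le_trans (le_of_eq ?_) (Finset.single_le_sum (fun l _ => hn3 l) (Finset.mem_univ hex.choose))
            rw [if_pos ⟨hne, hex.choose_spec.1, hex.choose_spec.2⟩]
          rw [if_pos hg]
          nlinarith
        · rw [if_neg hg]
          linarith
  refine (Finset.sum_le_sum fun x _ => Finset.sum_le_sum fun y _ => hmain x y).trans ?_
  simp_rw [Finset.sum_add_distrib]
  have j1 : ∑ x, ∑ y, p x y * (if ∀ l, ¬ G' (c l) x then 1 else 0)
      = ∑ x, px x * (if ∀ l, ¬ G' (c l) x then 1 else 0) := by
    refine Finset.sum_congr rfl fun x _ => ?_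
    rw [Finset.sum_mul]
  have j2 : ∑ x, ∑ y, (if ∀ l, ¬ G' (c l) x then 0 else if G2 (c (ℓ x)) y then 0 else p x y) ≤ s := by
    have : ∀ x, ∑ y, (if ∀ l, ¬ G' (c l) x then 0 else if G2 (c (ℓ x)) y then 0 else p x y) ≤ s * px x := by
      intro x
      by_cases hf : ∀ l, ¬ G' (c l) x
      · simp only [if_pos hf, Finset.sum_const_zero]
        exact mul_nonneg hs.le (hpx0 x)
      · simp only [if_neg hf]
        exact ((hG' _ _).1 (hℓ x hf)).2
    refine (Finset.sum_le_sum fun x _ => this x).trans ?_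
    rw [← Finset.mul_sum]
    have : ∑ x, px x = 1 := hp1
    rw [this, mul_one]
  rw [j1]
  linarith


/-! ### from Wyner-Ziv codes to type codes -/

open Classical in
lemma type_code {X Y V : Type} [Fintype X] [Fintype Y] [DecidableEq X] [DecidableEq Y]
    [DecidableEq V] [Fintype V]
    (P : X → Y → ℝ) (hP0 : ∀ x y, 0 ≤ P x y) (f : X → Y → V) (t : X → Finset X → ℝ)
    (ht : ∀ x w, t x w ≠ 0 → w ∈ maxSolvableEdges {s : X × Y | P s.1 s.2 ≠ 0} f ∧ x ∈ w)
    (n B : ℕ) (bin : (Fin n → X) → Fin B) (ω : (Fin n → X) → (Fin n → Finset X))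
    (dec : Fin B → (Fin n → Y) → (Fin n → Finset X)) :
    ∃ (φ : (Fin n → X) → Fin (B * (n + 1) ^ (Fintype.card (Finset X × X))))
      (ψ : Fin (B * (n + 1) ^ (Fintype.card (Finset X × X))) → (Fin n → Y) → (V → ℕ)),
      errProb (fun (x : Fin n → X) (y : Fin n → Y) => ∏ i, P (x i) (y i))
        (fun (x : Fin n → X) (y : Fin n → Y) => typeOf (fun i => f (x i) (y i))) φ ψ
      ≤ ∑ x, ∑ y, (if (∀ i, t (x i) (ω x i) ≠ 0) ∧ dec (bin x) y = ω x then 0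
          else ∏ i, P (x i) (y i)) := by
  have hpot : ∀ w : Finset X, ∃ (u : X → V → ℤ) (g : Y → V → ℤ),
      SolvableEdge {s : X × Y | P s.1 s.2 ≠ 0} f w → ∀ a b, a ∈ w → P a b ≠ 0 → ∀ v,
        (if f a b = v then (1:ℤ) else 0) = u a v + g b v := by
    intro w
    by_cases hw : SolvableEdge {s : X × Y | P s.1 s.2 ≠ 0} f w
    · obtain ⟨u, g, h⟩ := solvable_potential _ f w hw
      exact ⟨u, g, fun _ a b ha hab => h a b ha hab⟩
    · exact ⟨fun _ _ => 0, fun _ _ => 0, fun h => absurd h hw⟩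
  choose u g hug using hpot
  let e : (Fin B × ((Finset X × X) → Fin (n + 1))) ≃ Fin (B * (n + 1) ^ (Fintype.card (Finset X × X))) :=
    Fintype.equivFinOfCardEq (by simp)
  refine ⟨fun x => e (bin x, fun p => ⟨typeOf (fun i => (ω x i, x i)) p, ?_⟩),
    fun m y v => (∑ p : Finset X × X, (((e.symm m).2 p : ℕ) : ℤ) * u p.1 p.2 v
      + ∑ i, g (dec (e.symm m).1 y i) (y i) v).toNat, ?_⟩
  · unfold typeOf
    have := Finset.card_filter_le (Finset.univ : Finset (Fin n)) (fun i => (ω x i, x i) = p)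
    simp only [Finset.card_univ, Fintype.card_fin] at this
    exact Nat.lt_succ_of_le (le_trans (le_of_eq (by congr)) this)
  unfold errProb
  refine Finset.sum_le_sum fun x _ => Finset.sum_le_sum fun y _ => ?_
  beta_reduce
  have hnn : 0 ≤ ∏ i, P (x i) (y i) := Finset.prod_nonneg fun i _ => hP0 _ _
  by_cases hz : ∏ i, P (x i) (y i) = 0
  · rw [hz, ite_self, ite_self]
  by_cases hg : (∀ i, t (x i) (ω x i) ≠ 0) ∧ dec (bin x) y = ω x
  swap
  · rw [if_neg hg]
    split_ifs; exacts [hnn, le_rfl]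
  rw [if_pos hg, if_pos]
  funext v
  simp only [Equiv.symm_apply_apply, hg.2]
  have h1 : (∑ p : Finset X × X, ((typeOf (fun i => (ω x i, x i)) p : ℕ) : ℤ) * u p.1 p.2 v)
      = ∑ i, u (ω x i) (x i) v := by
    simp_rw [typeOf_eq_sum, Finset.sum_mul]
    rw [Finset.sum_comm]
    refine Finset.sum_congr rfl fun i _ => ?_
    simp
  rw [h1, ← Finset.sum_add_distrib]
  have h2 : ∑ i, (u (ω x i) (x i) v + g (ω x i) (y i) v) = (typeOf (fun i => f (x i) (y i)) v : ℤ) := by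
    rw [typeOf_eq_sum]
    refine Finset.sum_congr rfl fun i _ => ?_
    have := ht _ _ (hg.1 i)
    refine (hug (ω x i) this.1.1 (x i) (y i) this.2 ?_ v).symm
    intro h
    exact hz (Finset.prod_eq_zero (Finset.mem_univ i) h)
  rw [h2, Int.toNat_natCast]

/-! ### i.i.d. specialisation of the one-shot bound -/

set_option maxHeartbeats 1600000 in
open Classical in
lemma code_n {X Y W : Type} [Fintype X] [Fintype Y] [Fintype W]
    (P : X → Y → ℝ) (hP0 : ∀ x y, 0 ≤ P x y) (hP1 : ∑ x, ∑ y, P x y = 1)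
    (t : X → W → ℝ) (ht0 : ∀ x w, 0 ≤ t x w) (ht1 : ∀ x, ∑ w, t x w = 1)
    (PW : W → ℝ) (hPW : ∀ w, PW w = ∑ x, ∑ y, P x y * t x w)
    (PY : Y → ℝ) (hPY : ∀ y, PY y = ∑ x, P x y)
    (PWY : W → Y → ℝ) (hPWY : ∀ w y, PWY w y = ∑ x, P x y * t x w)
    (I1 I2 : ℝ)
    (hI1 : I1 = ∑ z : (X × Y) × W, P z.1.1 z.1.2 * t z.1.1 z.2 * Real.logb 2 (t z.1.1 z.2 / PW z.2))
    (hI2 : I2 = ∑ z : (X × Y) × W, P z.1.1 z.1.2 * t z.1.1 z.2 *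
      Real.logb 2 (PWY z.2 z.1.2 / (PW z.2 * PY z.1.2)))
    (δ : ℝ) (hδ : 0 < δ) :
    ∃ C : ℝ, 0 ≤ C ∧ ∀ n : ℕ, 0 < n → ∀ s : ℝ, 0 < s → ∀ L B : ℕ, 0 < L → 0 < B →
      ∃ (bin : (Fin n → X) → Fin B) (ω : (Fin n → X) → (Fin n → W))
        (dec : Fin B → (Fin n → Y) → (Fin n → W)),
        ∑ x : Fin n → X, ∑ y : Fin n → Y,
          (if (∀ i, t (x i) (ω x i) ≠ 0) ∧ dec (bin x) y = ω x then 0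
            else ∏ i, P (x i) (y i))
        ≤ C / n + C / n / s + Real.exp (-(L / (2:ℝ) ^ (n * (I1 + δ)))) + s
          + L * (2:ℝ) ^ (-(n * (I2 - δ))) / B := by
  set q : (X × Y) × W → ℝ := fun z => P z.1.1 z.1.2 * t z.1.1 z.2 with hq
  set g1 : (X × Y) × W → ℝ := fun z => Real.logb 2 (t z.1.1 z.2 / PW z.2) with hg1
  set g2 : (X × Y) × W → ℝ := fun z => Real.logb 2 (PWY z.2 z.1.2 / (PW z.2 * PY z.1.2)) with hg2
  have hq0 : ∀ z, 0 ≤ q z := fun z => mul_nonneg (hP0 _ _) (ht0 _ _)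
  have hq1 : ∑ z, q z = 1 := by
    rw [Fintype.sum_prod_type, Fintype.sum_prod_type]
    simp only [hq, ← Finset.mul_sum, ht1, mul_one, hP1]
  have hPW0 : ∀ w, 0 ≤ PW w := fun w => by
    rw [hPW]; exact Finset.sum_nonneg fun x _ => Finset.sum_nonneg fun y _ => mul_nonneg (hP0 _ _) (ht0 _ _)
  have hPY0 : ∀ y, 0 ≤ PY y := fun y => by
    rw [hPY]; exact Finset.sum_nonneg fun x _ => hP0 _ _
  have hPWY0 : ∀ w y, 0 ≤ PWY w y := fun w y => by
    rw [hPWY]; exact Finset.sum_nonneg fun x _ => mul_nonneg (hP0 _ _) (ht0 _ _)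
  have hPW1 : ∑ w, PW w = 1 := by
    simp_rw [hPW]
    rw [Finset.sum_comm, ← hP1]
    refine Finset.sum_congr rfl fun x _ => ?_
    rw [Finset.sum_comm]
    refine Finset.sum_congr rfl fun y _ => ?_
    rw [← Finset.mul_sum, ht1, mul_one]
  have hPWYs : ∀ y, ∑ w, PWY w y = PY y := by
    intro y
    simp_rw [hPWY, hPY]
    rw [Finset.sum_comm]
    refine Finset.sum_congr rfl fun x _ => ?_
    rw [← Finset.mul_sum, ht1, mul_one]
  have hpos : ∀ z, q z ≠ 0 → 0 < t z.1.1 z.2 ∧ 0 < P z.1.1 z.1.2 ∧ 0 < PW z.2 ∧ 0 < PY z.1.2 ∧ 0 < PWY z.2 z.1.2 := by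
    rintro ⟨⟨x, y⟩, w⟩ hz
    have hqz : 0 < q ((x, y), w) := lt_of_le_of_ne (hq0 _) (Ne.symm hz)
    simp only [hq] at hqz hz ⊢
    have ht : 0 < t x w := lt_of_le_of_ne (ht0 _ _) (Ne.symm (right_ne_zero_of_mul hz))
    have hP : 0 < P x y := lt_of_le_of_ne (hP0 _ _) (Ne.symm (left_ne_zero_of_mul hz))
    have h1 : 0 < PWY w y := by
      rw [hPWY]
      exact lt_of_lt_of_le hqz (Finset.single_le_sum (f := fun x => P x y * t x w)
        (fun x _ => mul_nonneg (hP0 _ _) (ht0 _ _)) (Finset.mem_univ x))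
    have h2 : 0 < PY y := by
      rw [hPY]
      exact lt_of_lt_of_le hP (Finset.single_le_sum (f := fun x => P x y)
        (fun x _ => hP0 _ _) (Finset.mem_univ x))
    have h3 : 0 < PW w := by
      rw [hPW, Finset.sum_comm]
      refine lt_of_lt_of_le h1 ?_
      rw [hPWY]
      exact (Finset.single_le_sum (f := fun y => ∑ x, P x y * t x w)
        (fun y _ => Finset.sum_nonneg fun x _ => mul_nonneg (hP0 _ _) (ht0 _ _)) (Finset.mem_univ y))
    exact ⟨ht, hP, h3, h2, h1⟩
  have hC1 : 0 ≤ (∑ a, q a * (g1 a - ∑ a, q a * g1 a) ^ 2) / δ ^ 2 :=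
    div_nonneg (Finset.sum_nonneg fun z _ => mul_nonneg (hq0 z) (sq_nonneg _)) (sq_nonneg _)
  have hC2 : 0 ≤ (∑ a, q a * (g2 a - ∑ a, q a * g2 a) ^ 2) / δ ^ 2 :=
    div_nonneg (Finset.sum_nonneg fun z _ => mul_nonneg (hq0 z) (sq_nonneg _)) (sq_nonneg _)
  refine ⟨(∑ a, q a * (g1 a - ∑ a, q a * g1 a) ^ 2) / δ ^ 2
    + (∑ a, q a * (g2 a - ∑ a, q a * g2 a) ^ 2) / δ ^ 2, add_nonneg hC1 hC2, ?_⟩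
  intro n hn s hs L B hL hB
  have hA : (0:ℝ) < (2:ℝ) ^ (n * (I1 + δ)) := Real.rpow_pos_of_pos two_pos _
  have hD : (0:ℝ) < (2:ℝ) ^ (-(n * (I2 - δ))) := Real.rpow_pos_of_pos two_pos _
  set A := (2:ℝ) ^ (n * (I1 + δ)) with hAdef
  set D := (2:ℝ) ^ (-(n * (I2 - δ))) with hDdef
  have hlA : Real.logb 2 A = n * (I1 + δ) := by rw [hAdef, Real.logb_rpow two_pos (by norm_num)]
  have hlD : Real.logb 2 D = -(n * (I2 - δ)) := by rw [hDdef, Real.logb_rpow two_pos (by norm_num)]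
  obtain ⟨G1, hG1⟩ : ∃ G1 : (Fin n → W) → (Fin n → X) → Prop, ∀ w x, G1 w x ↔
      ((∀ i, t (x i) (w i) ≠ 0) ∧ ∏ i, t (x i) (w i) ≤ A * ∏ i, PW (w i)) := ⟨_, fun _ _ => Iff.rfl⟩
  obtain ⟨G2, hG2⟩ : ∃ G2 : (Fin n → W) → (Fin n → Y) → Prop, ∀ w y, G2 w y ↔
      (0 < ∏ i, PY (y i) ∧ (∏ i, PW (w i)) * ∏ i, PY (y i) ≤ D * ∏ i, PWY (w i) (y i)) :=
    ⟨_, fun _ _ => Iff.rfl⟩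
  obtain ⟨bin, ω, dec, h⟩ := one_shot (fun (x : Fin n → X) (y : Fin n → Y) => ∏ i, P (x i) (y i))
    (fun x y => Finset.prod_nonneg fun i _ => hP0 _ _)
    (by
      rw [sum_pair]
      exact sum_pn_one (fun z : X × Y => P z.1 z.2) (by rw [Fintype.sum_prod_type]; exact hP1))
    (fun (x : Fin n → X) (w : Fin n → W) => ∏ i, t (x i) (w i))
    (fun x w => Finset.prod_nonneg fun i _ => ht0 _ _)
    (by
      intro x
      rw [sum_prod_pi (fun i w => t (x i) w)]
      simp [ht1])
    (fun w => ∏ i, PW (w i)) (fun w => pn_nonneg hPW0 w) (sum_pn_one PW hPW1)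
    G1 G2
    A D (((∑ a, q a * (g1 a - ∑ a, q a * g1 a) ^ 2) / δ ^ 2
    + (∑ a, q a * (g2 a - ∑ a, q a * g2 a) ^ 2) / δ ^ 2) / n) s hA hs (fun w x h => ((hG1 w x).1 h).2)
    (by
      intro y
      by_cases hy : 0 < ∏ i, PY (y i)
      · have h1 : ∑ w : Fin n → W, D * ∏ i, PWY (w i) (y i) = D * ∏ i, PY (y i) := by
          rw [← Finset.mul_sum, sum_prod_pi (fun i w => PWY w (y i))]
          simp_rw [hPWYs]
        have h2 : (∑ w : Fin n → W, (if G2 w y then ∏ i, PW (w i) else 0)) * ∏ i, PY (y i) ≤ D * ∏ i, PY (y i) := by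
          rw [← h1, Finset.sum_mul]
          refine Finset.sum_le_sum fun w _ => ?_
          split_ifs with hc
          · exact ((hG2 w y).1 hc).2
          · rw [zero_mul]
            exact mul_nonneg hD.le (Finset.prod_nonneg fun i _ => hPWY0 _ _)
        exact le_of_mul_le_mul_right h2 hy
      · simp only [hG2, hy, false_and, if_false, Finset.sum_const_zero]
        exact hD.le)
    (by
      have key : ∀ (x : Fin n → X) (y : Fin n → Y) (w : Fin n → W),
          (if G1 w x ∧ G2 w y then 0
            else (∏ i, P (x i) (y i)) * ∏ i, t (x i) (w i))
          ≤ (if n * (I1 + δ) ≤ ∑ i, g1 ((x i, y i), w i) then ∏ i, q ((x i, y i), w i) else 0)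
            + (if ∑ i, g2 ((x i, y i), w i) ≤ n * (I2 - δ) then ∏ i, q ((x i, y i), w i) else 0) := by
        intro x y w
        have hqq : (∏ i, P (x i) (y i)) * ∏ i, t (x i) (w i) = ∏ i, q ((x i, y i), w i) := by
          rw [← Finset.prod_mul_distrib]
        rw [hqq]
        have hnn : 0 ≤ ∏ i, q ((x i, y i), w i) := Finset.prod_nonneg fun i _ => hq0 _
        have hn1 : 0 ≤ (if n * (I1 + δ) ≤ ∑ i, g1 ((x i, y i), w i) then ∏ i, q ((x i, y i), w i) else 0) := by
          split_ifs; exacts [hnn, le_rfl]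
        have hn2 : 0 ≤ (if ∑ i, g2 ((x i, y i), w i) ≤ n * (I2 - δ) then ∏ i, q ((x i, y i), w i) else 0) := by
          split_ifs; exacts [hnn, le_rfl]
        by_cases hz : ∏ i, q ((x i, y i), w i) = 0
        · rw [hz] at hn1 hn2 ⊢
          rw [ite_self]; exact add_nonneg hn1 hn2
        have hz' : ∀ i, q ((x i, y i), w i) ≠ 0 := fun i hi => hz (Finset.prod_eq_zero (Finset.mem_univ i) hi)
        have hp := fun i => hpos _ (hz' i)
        simp only at hp
        by_cases c1 : n * (I1 + δ) ≤ ∑ i, g1 ((x i, y i), w i)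
        · rw [if_pos c1]
          refine le_trans ?_ (le_add_of_nonneg_right hn2)
          split_ifs; exacts [hnn, le_rfl]
        by_cases c2 : ∑ i, g2 ((x i, y i), w i) ≤ n * (I2 - δ)
        · rw [if_pos c2]
          refine le_trans ?_ (le_add_of_nonneg_left hn1)
          split_ifs; exacts [hnn, le_rfl]
        rw [if_pos]
        · exact add_nonneg hn1 hn2
        have pt : 0 < ∏ i, t (x i) (w i) := Finset.prod_pos fun i _ => (hp i).1
        have pW : 0 < ∏ i, PW (w i) := Finset.prod_pos fun i _ => (hp i).2.2.1
        have pY : 0 < ∏ i, PY (y i) := Finset.prod_pos fun i _ => (hp i).2.2.2.1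
        have pWY : 0 < ∏ i, PWY (w i) (y i) := Finset.prod_pos fun i _ => (hp i).2.2.2.2
        have l1 : ∑ i, g1 ((x i, y i), w i) = Real.logb 2 ((∏ i, t (x i) (w i)) / ∏ i, PW (w i)) := by
          rw [← Finset.prod_div_distrib, Real.logb_prod]
          intro i _
          exact (div_pos (hp i).1 (hp i).2.2.1).ne'
        have l2 : ∑ i, g2 ((x i, y i), w i) = Real.logb 2 ((∏ i, PWY (w i) (y i)) /
            ((∏ i, PW (w i)) * ∏ i, PY (y i))) := by
          rw [← Finset.prod_mul_distrib, ← Finset.prod_div_distrib, Real.logb_prod]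
          intro i _
          exact (div_pos (hp i).2.2.2.2 (mul_pos (hp i).2.2.1 (hp i).2.2.2.1)).ne'
        refine ⟨(hG1 w x).2 ⟨fun i => (hp i).1.ne', ?_⟩, (hG2 w y).2 ⟨pY, ?_⟩⟩
        · rw [← div_le_iff₀ pW]
          rw [← Real.logb_le_logb (b := 2) (by norm_num) (div_pos pt pW) hA, hlA, ← l1]
          exact (not_le.1 c1).le
        · have hDinv : D⁻¹ ≤ (∏ i, PWY (w i) (y i)) / ((∏ i, PW (w i)) * ∏ i, PY (y i)) := by
            rw [← Real.logb_le_logb (b := 2) (by norm_num) (inv_pos.2 hD) (div_pos pWY (mul_pos pW pY)),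
              Real.logb_inv, hlD, ← l2, neg_neg]
            exact (not_le.1 c2).le
          rw [le_div_iff₀ (mul_pos pW pY), inv_mul_le_iff₀ hD] at hDinv
          exact hDinv
      refine (Finset.sum_le_sum fun x _ => Finset.sum_le_sum fun y _ =>
        Finset.sum_le_sum fun w _ => key x y w).trans ?_
      simp_rw [Finset.sum_add_distrib]
      rw [add_div]
      refine add_le_add ?_ ?_
      · rw [sum_pair (fun (x : Fin n → X) (y : Fin n → Y) => ∑ w : Fin n → W,
          (if n * (I1 + δ) ≤ ∑ i, g1 ((x i, y i), w i) then ∏ i, q ((x i, y i), w i) else 0)),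
          sum_pair (fun (z : Fin n → X × Y) (w : Fin n → W) =>
          (if n * (I1 + δ) ≤ ∑ i, g1 (((z i).1, (z i).2), w i) then ∏ i, q (((z i).1, (z i).2), w i) else 0))]
        refine wlln q hq0 hq1 g1 δ hδ hn (fun z => n * (I1 + δ) ≤ ∑ i, g1 (z i)) ?_
        intro z _ hz
        have : I1 = ∑ a, q a * g1 a := hI1
        rw [← this]
        refine le_trans ?_ (le_abs_self _)
        linarith
      · rw [sum_pair (fun (x : Fin n → X) (y : Fin n → Y) => ∑ w : Fin n → W,
          (if ∑ i, g2 ((x i, y i), w i) ≤ n * (I2 - δ) then ∏ i, q ((x i, y i), w i) else 0)),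
          sum_pair (fun (z : Fin n → X × Y) (w : Fin n → W) =>
          (if ∑ i, g2 (((z i).1, (z i).2), w i) ≤ n * (I2 - δ) then ∏ i, q (((z i).1, (z i).2), w i) else 0))]
        refine wlln q hq0 hq1 g2 δ hδ hn (fun z => ∑ i, g2 (z i) ≤ n * (I2 - δ)) ?_
        intro z _ hz
        have : I2 = ∑ a, q a * g2 a := hI2
        rw [← this]
        refine le_trans ?_ (neg_le_abs _)
        linarith)
    L B hL hB
  refine ⟨bin, ω, dec, le_trans (Finset.sum_le_sum fun x _ => Finset.sum_le_sum fun y _ => ?_) h⟩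
  have hnn : 0 ≤ ∏ i, P (x i) (y i) := Finset.prod_nonneg fun i _ => hP0 _ _
  beta_reduce
  split_ifs with h1 h2 h2
  · exact le_rfl
  · exact hnn
  · exact absurd ⟨((hG1 _ _).1 h2.1).1, h2.2⟩ h1
  · exact le_rfl

/-! ### achievability -/

lemma trip_pos {X Y W : Type} [Fintype X] [Fintype Y] [Fintype W]
    (P : X → Y → ℝ) (hP0 : ∀ x y, 0 ≤ P x y)
    (t : X → W → ℝ) (ht0 : ∀ x w, 0 ≤ t x w) (x : X) (y : Y) (w : W) (hz : P x y * t x w ≠ 0) :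
    0 < t x w ∧ 0 < P x y ∧ 0 < (∑ x, ∑ y, P x y * t x w) ∧ 0 < (∑ x, P x y) ∧
      0 < ∑ x, P x y * t x w := by
  have hqz : 0 < P x y * t x w := lt_of_le_of_ne (mul_nonneg (hP0 _ _) (ht0 _ _)) (Ne.symm hz)
  have ht : 0 < t x w := lt_of_le_of_ne (ht0 _ _) (Ne.symm (right_ne_zero_of_mul hz))
  have hP : 0 < P x y := lt_of_le_of_ne (hP0 _ _) (Ne.symm (left_ne_zero_of_mul hz))
  have h1 : 0 < ∑ x, P x y * t x w := 
    lt_of_lt_of_le hqz (Finset.single_le_sum (f := fun x => P x y * t x w)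
      (fun x _ => mul_nonneg (hP0 _ _) (ht0 _ _)) (Finset.mem_univ x))
  have h2 : 0 < ∑ x, P x y :=
    lt_of_lt_of_le hP (Finset.single_le_sum (f := fun x => P x y)
      (fun x _ => hP0 _ _) (Finset.mem_univ x))
  have h3 : 0 < ∑ x, ∑ y, P x y * t x w := by
    rw [Finset.sum_comm]
    refine lt_of_lt_of_le h1 ?_
    exact (Finset.single_le_sum (f := fun y => ∑ x, P x y * t x w)
      (fun y _ => Finset.sum_nonneg fun x _ => mul_nonneg (hP0 _ _) (ht0 _ _)) (Finset.mem_univ y))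
  exact ⟨ht, hP, h3, h2, h1⟩

lemma condMI_split {X Y : Type} [Fintype X] [Fintype Y]
    (P : X → Y → ℝ) (hP0 : ∀ x y, 0 ≤ P x y)
    (t : X → Finset X → ℝ) (ht0 : ∀ x w, 0 ≤ t x w) :
    condMI P t = (∑ z : (X × Y) × Finset X, P z.1.1 z.1.2 * t z.1.1 z.2 *
        Real.logb 2 (t z.1.1 z.2 / ∑ x, ∑ y, P x y * t x z.2))
      - ∑ z : (X × Y) × Finset X, P z.1.1 z.1.2 * t z.1.1 z.2 *
      Real.logb 2 ((∑ x, P x z.1.2 * t x z.2) / ((∑ x, ∑ y, P x y * t x z.2) * ∑ x, P x z.1.2)) := by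
  rw [← Finset.sum_sub_distrib, Fintype.sum_prod_type, Fintype.sum_prod_type]
  unfold condMI
  rw [Finset.sum_comm]
  refine Finset.sum_congr rfl fun x _ => ?_
  rw [Finset.sum_comm]
  refine Finset.sum_congr rfl fun y _ => Finset.sum_congr rfl fun w _ => ?_
  by_cases hz : P x y * t x w = 0
  · rw [mul_comm (t x w), hz]; simp
  obtain ⟨h1, h2, h3, h4, h5⟩ := trip_pos P hP0 t ht0 x y w hz
  have e : ∑ x', t x' w * P x' y = ∑ x', P x' y * t x' w :=
    Finset.sum_congr rfl fun _ _ => mul_comm _ _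
  rw [e, ← mul_sub, ← Real.logb_div (div_pos h1 h3).ne' (div_pos h5 (mul_pos h3 h4)).ne', mul_comm (t x w)]
  congr 2
  have := h1.ne'; have := h2.ne'; have := h3.ne'; have := h4.ne'; have := h5.ne'
  generalize (∑ x, ∑ y, P x y * t x w) = a at *
  generalize (∑ x, P x y * t x w) = b at *
  generalize (∑ x, P x y) = c at *
  field_simp

lemma I1_nonneg {X Y W : Type} [Fintype X] [Fintype Y] [Fintype W]
    (P : X → Y → ℝ) (hP0 : ∀ x y, 0 ≤ P x y) (hP1 : ∑ x, ∑ y, P x y = 1)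
    (t : X → W → ℝ) (ht0 : ∀ x w, 0 ≤ t x w) (ht1 : ∀ x, ∑ w, t x w = 1) :
    0 ≤ ∑ z : (X × Y) × W, P z.1.1 z.1.2 * t z.1.1 z.2 *
        Real.logb 2 (t z.1.1 z.2 / ∑ x, ∑ y, P x y * t x z.2) := by
  have hPW1 : ∑ w, ∑ x, ∑ y, P x y * t x w = 1 := by
    rw [Finset.sum_comm, ← hP1]
    refine Finset.sum_congr rfl fun x _ => ?_
    rw [Finset.sum_comm]
    refine Finset.sum_congr rfl fun y _ => ?_
    rw [← Finset.mul_sum, ht1, mul_one]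
  refine gibbs (fun z : (X × Y) × W => P z.1.1 z.1.2 * t z.1.1 z.2)
    (fun z => t z.1.1 z.2 / ∑ x, ∑ y, P x y * t x z.2) (fun z => mul_nonneg (hP0 _ _) (ht0 _ _)) ?_ ?_ ?_
  · rw [Fintype.sum_prod_type, Fintype.sum_prod_type]
    simp only [← Finset.mul_sum, ht1, mul_one, hP1]
  · rintro ⟨⟨x, y⟩, w⟩ hz
    obtain ⟨h1, h2, h3, h4, h5⟩ := trip_pos P hP0 t ht0 x y w hz
    exact div_pos h1 h3
  · have : ∀ z : (X × Y) × W, P z.1.1 z.1.2 * t z.1.1 z.2 / (t z.1.1 z.2 / ∑ x, ∑ y, P x y * t x z.2)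
        ≤ P z.1.1 z.1.2 * ∑ x, ∑ y, P x y * t x z.2 := by
      rintro ⟨⟨x, y⟩, w⟩
      by_cases hz : P x y * t x w = 0
      · simp only [hz, zero_div]
        exact mul_nonneg (hP0 _ _) (Finset.sum_nonneg fun x _ => Finset.sum_nonneg fun y _ =>
          mul_nonneg (hP0 _ _) (ht0 _ _))
      obtain ⟨h1, h2, h3, h4, h5⟩ := trip_pos P hP0 t ht0 x y w hz
      apply le_of_eq
      have := h1.ne'; have := h3.ne'
      dsimp only
      generalize (∑ x, ∑ y, P x y * t x w) = a at *
      field_simp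
    refine (Finset.sum_le_sum fun z _ => this z).trans ?_
    rw [Fintype.sum_prod_type, Fintype.sum_prod_type]
    simp only [← Finset.mul_sum, hPW1, mul_one, hP1, le_refl]

lemma log_small (K : ℝ) (hK : 0 ≤ K) (ε : ℝ) (hε : 0 < ε) :
    ∀ᶠ n : ℕ in atTop, (2 + K * Real.logb 2 (n + 1)) / n ≤ ε := by
  have hl : 0 < Real.log 2 := Real.log_pos (by norm_num)
  have hsq : Tendsto (fun n : ℕ => Real.sqrt n) atTop atTop :=
    Real.tendsto_sqrt_atTop.comp tendsto_natCast_atTop_atTop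
  have h1 : Tendsto (fun n : ℕ => (2:ℝ) / n + (4 * K / Real.log 2) / Real.sqrt n) atTop (nhds (0 + 0)) :=
    (tendsto_const_div_atTop_nhds_zero_nat 2).add (tendsto_const_nhds.div_atTop hsq)
  rw [add_zero] at h1
  filter_upwards [h1.eventually (gt_mem_nhds hε), eventually_gt_atTop 0] with n hn hn0
  refine le_trans ?_ hn.le
  have hn0' : (1:ℝ) ≤ n := by exact_mod_cast hn0
  have hr : 0 < Real.sqrt n := Real.sqrt_pos.2 (by linarith)
  have hrr : Real.sqrt n * Real.sqrt n = n := Real.mul_self_sqrt (by linarith)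
  have hlog : Real.log (n + 1) ≤ 4 * Real.sqrt n := by
    have e1 : Real.log (n + 1) ≤ 2 * Real.sqrt (n + 1) := by
      have := Real.log_le_self (Real.sqrt_nonneg ((n:ℝ) + 1))
      rw [Real.log_sqrt (by linarith)] at this
      linarith
    have e2 : Real.sqrt (n + 1) ≤ 2 * Real.sqrt n := by
      rw [Real.sqrt_le_left (by positivity)]
      nlinarith
    linarith
  rw [add_div]
  refine add_le_add le_rfl ?_
  have h3 : Real.logb 2 (n + 1) ≤ 4 * Real.sqrt n / Real.log 2 := by
    unfold Real.logb
    gcongr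
  rw [div_le_iff₀ (by linarith)]
  refine (mul_le_mul_of_nonneg_left h3 hK).trans (le_of_eq ?_)
  have key : ∀ r N l : ℝ, r ≠ 0 → l ≠ 0 → r * r = N → K * (4 * r / l) = 4 * K / l / r * N := by
    intro r N l hr hl h
    subst h
    field_simp
  exact key _ _ _ hr.ne' hl.ne' hrr

lemma pow_bounds (I1 I2 δ : ℝ) (hI1 : 0 ≤ I1) (hI : 0 ≤ I1 - I2) (hδ : 0 < δ) (n : ℕ) (L B : ℕ)
    (hL : L = ⌈(2:ℝ) ^ (n * (I1 + 2 * δ))⌉₊)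
    (hB : B = ⌈L * (2:ℝ) ^ (-(n * (I2 - δ))) * (2:ℝ) ^ (n * δ)⌉₊) :
    0 < L ∧ 0 < B ∧ Real.exp (-(L / (2:ℝ) ^ (n * (I1 + δ)))) ≤ ((2:ℝ) ^ (-δ)) ^ n ∧
      L * (2:ℝ) ^ (-(n * (I2 - δ))) / B ≤ ((2:ℝ) ^ (-δ)) ^ n ∧
      Real.logb 2 B ≤ 2 + n * (I1 - I2 + 4 * δ) := by
  have pp : ∀ a : ℝ, 0 < (2:ℝ) ^ a := fun a => Real.rpow_pos_of_pos two_pos a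
  have hn : (0:ℝ) ≤ n := Nat.cast_nonneg n
  have hLpos : 0 < L := by rw [hL]; exact Nat.ceil_pos.2 (pp _)
  have hLpos' : (0:ℝ) < L := by exact_mod_cast hLpos
  have hBpos : 0 < B := by
    rw [hB]; exact Nat.ceil_pos.2 (mul_pos (mul_pos hLpos' (pp _)) (pp _))
  have hBpos' : (0:ℝ) < B := by exact_mod_cast hBpos
  have hL1 : (2:ℝ) ^ (n * (I1 + 2 * δ)) ≤ L := by rw [hL]; exact Nat.le_ceil _
  have hL2 : (L:ℝ) ≤ 2 * (2:ℝ) ^ (n * (I1 + 2 * δ)) := by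
    have h1 : (L:ℝ) < (2:ℝ) ^ (n * (I1 + 2 * δ)) + 1 := by rw [hL]; exact Nat.ceil_lt_add_one (pp _).le
    have h2 : (1:ℝ) ≤ (2:ℝ) ^ (n * (I1 + 2 * δ)) :=
      Real.one_le_rpow (by norm_num) (mul_nonneg hn (by linarith))
    linarith
  have hB1 : L * (2:ℝ) ^ (-(n * (I2 - δ))) * (2:ℝ) ^ (n * δ) ≤ B := by rw [hB]; exact Nat.le_ceil _
  have hB2 : (B:ℝ) < L * (2:ℝ) ^ (-(n * (I2 - δ))) * (2:ℝ) ^ (n * δ) + 1 := by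
    rw [hB]; exact Nat.ceil_lt_add_one (mul_pos (mul_pos hLpos' (pp _)) (pp _)).le
  have epow : ((2:ℝ) ^ (-δ)) ^ n = (2:ℝ) ^ (-(n * δ)) := by
    rw [← Real.rpow_mul_natCast (by norm_num)]
    congr 1; ring
  refine ⟨hLpos, hBpos, ?_, ?_, ?_⟩
  · rw [epow, Real.rpow_neg (by norm_num), Real.exp_neg]
    refine inv_anti₀ (pp _) ?_
    have h1 : (2:ℝ) ^ (n * δ) ≤ L / (2:ℝ) ^ (n * (I1 + δ)) := by
      rw [le_div_iff₀ (pp _), ← Real.rpow_add two_pos]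
      refine le_trans (le_of_eq ?_) hL1
      congr 1; ring
    have h2 := Real.add_one_le_exp (L / (2:ℝ) ^ (n * (I1 + δ)))
    linarith
  · rw [epow, Real.rpow_neg (by norm_num : (0:ℝ) ≤ 2) (n * δ), div_le_iff₀ hBpos', inv_mul_eq_div, le_div_iff₀ (pp _)]
    exact hB1
  · have h1 : L * (2:ℝ) ^ (-(n * (I2 - δ))) * (2:ℝ) ^ (n * δ) ≤ 2 * (2:ℝ) ^ (n * (I1 - I2 + 4 * δ)) := by
      have e : 2 * (2:ℝ) ^ (n * (I1 - I2 + 4 * δ)) = 2 * (2:ℝ) ^ (n * (I1 + 2 * δ)) * (2:ℝ) ^ (-(n * (I2 - δ)))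
          * (2:ℝ) ^ (n * δ) := by
        rw [mul_assoc, mul_assoc, ← Real.rpow_add two_pos, ← Real.rpow_add two_pos]
        congr 2; ring
      rw [e]
      have := (pp (-(n * (I2 - δ)))).le
      have := (pp (n * δ)).le
      gcongr
    have h2 : (1:ℝ) ≤ (2:ℝ) ^ (n * (I1 - I2 + 4 * δ)) :=
      Real.one_le_rpow (by norm_num) (mul_nonneg hn (by linarith))
    have h3 : (B:ℝ) ≤ (2:ℝ) ^ (2 + n * (I1 - I2 + 4 * δ)) := by
      rw [Real.rpow_add two_pos]
      have : (2:ℝ) ^ (2:ℝ) = 4 := by norm_num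
      rw [this]
      linarith
    calc Real.logb 2 B ≤ Real.logb 2 ((2:ℝ) ^ (2 + n * (I1 - I2 + 4 * δ))) :=
          Real.logb_le_logb_of_le (by norm_num) hBpos' h3
      _ = _ := Real.logb_rpow two_pos (by norm_num)

lemma achiev {X Y V : Type} [Fintype X] [Fintype Y] [DecidableEq X] [DecidableEq Y]
    [DecidableEq V] [Fintype V]
    (P : X → Y → ℝ) (hP0 : ∀ x y, 0 ≤ P x y) (hP1 : ∑ x, ∑ y, P x y = 1) (f : X → Y → V)
    (t : X → Finset X → ℝ) (ht0 : ∀ x w, 0 ≤ t x w) (ht1 : ∀ x, ∑ w, t x w = 1)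
    (ht : ∀ x w, t x w ≠ 0 → w ∈ maxSolvableEdges {s : X × Y | P s.1 s.2 ≠ 0} f ∧ x ∈ w)
    (δ : ℝ) (hδ : 0 < δ) :
    Achievable (fun n (x : Fin n → X) (y : Fin n → Y) => ∏ i, P (x i) (y i))
        (fun n (x : Fin n → X) (y : Fin n → Y) => typeOf (fun i => f (x i) (y i)))
        (condMI P t + 4 * δ) := by
  have hc0 : 0 ≤ condMI P t := condMI_nonneg P hP0 hP1 t ht0 ht1
  obtain ⟨I1, hI1⟩ : ∃ I1 : ℝ, I1 = ∑ z : (X × Y) × Finset X, P z.1.1 z.1.2 * t z.1.1 z.2 *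
        Real.logb 2 (t z.1.1 z.2 / ∑ x, ∑ y, P x y * t x z.2) := ⟨_, rfl⟩
  obtain ⟨I2, hI2⟩ : ∃ I2 : ℝ, I2 = ∑ z : (X × Y) × Finset X, P z.1.1 z.1.2 * t z.1.1 z.2 *
      Real.logb 2 ((∑ x, P x z.1.2 * t x z.2) / ((∑ x, ∑ y, P x y * t x z.2) * ∑ x, P x z.1.2)) :=
    ⟨_, rfl⟩
  have hcI : condMI P t = I1 - I2 := by rw [hI1, hI2]; exact condMI_split P hP0 t ht0
  have hI10 : 0 ≤ I1 := by rw [hI1]; exact I1_nonneg P hP0 hP1 t ht0 ht1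
  rw [hcI] at hc0 ⊢
  obtain ⟨C, hC0, hC⟩ := code_n P hP0 hP1 t ht0 ht1 (fun w => ∑ x, ∑ y, P x y * t x w) (fun _ => rfl)
    (fun y => ∑ x, P x y) (fun _ => rfl) (fun w y => ∑ x, P x y * t x w) (fun _ _ => rfl) I1 I2 hI1 hI2 δ hδ
  obtain ⟨L, hL⟩ : ∃ L : ℕ → ℕ, ∀ n, L n = ⌈(2:ℝ) ^ (n * (I1 + 2 * δ))⌉₊ := ⟨_, fun _ => rfl⟩
  obtain ⟨B, hB⟩ : ∃ B : ℕ → ℕ, ∀ n, B n = ⌈L n * (2:ℝ) ^ (-(n * (I2 - δ))) * (2:ℝ) ^ (n * δ)⌉₊ :=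
    ⟨_, fun _ => rfl⟩
  have hpb := fun n => pow_bounds I1 I2 δ hI10 hc0 hδ n (L n) (B n) (hL n) (hB n)
  have hTC := type_code P hP0 f t ht
  generalize Fintype.card (Finset X × X) = K at hTC
  have hM : ∀ n, 0 < B n * (n + 1) ^ K := fun n => Nat.mul_pos (hpb n).2.1 (pow_pos (Nat.succ_pos n) K)
  have hex : ∀ n, ∃ (φ : (Fin n → X) → Fin (B n * (n + 1) ^ K))
      (ψ : Fin (B n * (n + 1) ^ K) → (Fin n → Y) → (V → ℕ)), 0 < n →
      errProb (fun (x : Fin n → X) (y : Fin n → Y) => ∏ i, P (x i) (y i))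
        (fun (x : Fin n → X) (y : Fin n → Y) => typeOf (fun i => f (x i) (y i))) φ ψ
      ≤ C / n + (C + 1) / Real.sqrt n + 2 * ((2:ℝ) ^ (-δ)) ^ n := by
    intro n
    rcases Nat.eq_zero_or_pos n with h0 | hn
    · exact ⟨fun _ => ⟨0, hM n⟩, fun _ _ _ => 0, fun h => absurd h0 h.ne'⟩
    have hn' : (0:ℝ) < n := by exact_mod_cast hn
    have hr : 0 < Real.sqrt n := Real.sqrt_pos.2 hn'
    obtain ⟨h1, h2, h3, h4, _⟩ := hpb n
    obtain ⟨bin, ω, dec, h⟩ := hC n hn (1 / Real.sqrt n) (one_div_pos.2 hr) (L n) (B n) h1 h2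
    obtain ⟨φ, ψ, hφ⟩ := hTC n (B n) bin ω dec
    refine ⟨φ, ψ, fun _ => hφ.trans (le_trans (Finset.sum_le_sum fun x _ =>
      Finset.sum_le_sum fun y _ => le_of_eq ?_) (h.trans ?_))⟩
    · by_cases hg : (∀ i, t (x i) (ω x i) ≠ 0) ∧ dec (bin x) y = ω x
      · rw [if_pos hg, if_pos hg]
      · rw [if_neg hg, if_neg hg]
    have e : C / n / (1 / Real.sqrt n) = C / Real.sqrt n := by
      have hrr : Real.sqrt n * Real.sqrt n = n := Real.mul_self_sqrt hn'.le
      rw [div_div, mul_one_div]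
      congr 1
      rw [div_eq_iff hr.ne', hrr]
    rw [e, add_div]
    linarith
  choose φ ψ hφψ using hex
  refine ⟨by linarith, fun n => B n * (n + 1) ^ K, φ, ψ, ?_, ?_⟩
  · have hsq : Tendsto (fun n : ℕ => Real.sqrt n) atTop atTop :=
      Real.tendsto_sqrt_atTop.comp tendsto_natCast_atTop_atTop
    have hgeo : Tendsto (fun n : ℕ => ((2:ℝ) ^ (-δ)) ^ n) atTop (nhds 0) :=
      tendsto_pow_atTop_nhds_zero_of_lt_one (Real.rpow_nonneg (by norm_num) _)
        (Real.rpow_lt_one_of_one_lt_of_neg (by norm_num) (by linarith))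
    have hlim : Tendsto (fun n : ℕ => C / n + (C + 1) / Real.sqrt n + 2 * ((2:ℝ) ^ (-δ)) ^ n) atTop
        (nhds (0 + 0 + 2 * 0)) :=
      ((tendsto_const_div_atTop_nhds_zero_nat C).add (tendsto_const_nhds.div_atTop hsq)).add
        (hgeo.const_mul 2)
    rw [mul_zero, add_zero, add_zero] at hlim
    refine tendsto_of_tendsto_of_tendsto_of_le_of_le' tendsto_const_nhds hlim ?_ ?_
    · refine Eventually.of_forall fun n => ?_
      unfold errProb
      refine Finset.sum_nonneg fun x _ => Finset.sum_nonneg fun y _ => ?_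
      split_ifs
      exacts [le_rfl, Finset.prod_nonneg fun i _ => hP0 _ _]
    · filter_upwards [eventually_gt_atTop 0] with n hn
      exact hφψ n hn
  · intro ε hε
    filter_upwards [log_small K (Nat.cast_nonneg K) ε hε, eventually_gt_atTop 0] with n hn hn0
    have hn' : (0:ℝ) < n := by exact_mod_cast hn0
    have hBp : (0:ℝ) < B n := by exact_mod_cast (hpb n).2.1
    have e : Real.logb 2 ((B n * (n + 1) ^ K : ℕ) : ℝ) = Real.logb 2 (B n) + K * Real.logb 2 (n + 1) := by
      push_cast
      rw [Real.logb_mul hBp.ne' (by positivity), Real.logb_pow]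
    rw [e]
    have h5 := (hpb n).2.2.2.2
    rw [div_le_iff₀ hn'] at hn ⊢
    nlinarith

theorem optimal_rate_type_function_eq_hypergraph_entropy
    {X Y V : Type} [Fintype X] [Fintype Y] [Fintype V]
    [Nonempty X] [Nonempty Y]
    [DecidableEq X] [DecidableEq Y] [DecidableEq V]
    (P : X → Y → ℝ) (hP0 : ∀ x y, 0 ≤ P x y)
    (hP1 : ∑ x : X, ∑ y : Y, P x y = 1)
    (hfull : ∀ x : X, ∃ y : Y, P x y ≠ 0)
    (f : X → Y → V) :
    optRate (fun n (x : Fin n → X) (y : Fin n → Y) => ∏ i, P (x i) (y i))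
        (fun n (x : Fin n → X) (y : Fin n → Y) => typeOf (fun i => f (x i) (y i)))
      = hypEnt P (maxSolvableEdges {s : X × Y | P s.1 s.2 ≠ 0} f) := by
  have hedge : ∀ x : X, ∃ e ∈ maxSolvableEdges {s : X × Y | P s.1 s.2 ≠ 0} f, x ∈ e := by
    intro x
    obtain ⟨e, he, hs⟩ := exists_max_edge {s : X × Y | P s.1 s.2 ≠ 0} f {x} (single_solvable _ f x)
    exact ⟨e, he, hs (Finset.mem_singleton_self x)⟩
  choose e he hxe using hedge
  have ht0 : ∀ x w, (0:ℝ) ≤ (fun x w => if w = e x then 1 else 0 : X → Finset X → ℝ) x w := by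
    intro x w
    dsimp only
    split_ifs <;> norm_num
  have ht1 : ∀ x, ∑ w, (fun x w => if w = e x then 1 else 0 : X → Finset X → ℝ) x w = 1 := by
    intro x
    simp
  have ht : ∀ x w, (fun x w => if w = e x then 1 else 0 : X → Finset X → ℝ) x w ≠ 0 →
      w ∈ maxSolvableEdges {s : X × Y | P s.1 s.2 ≠ 0} f ∧ x ∈ w := by
    intro x w h
    by_cases hw : w = e x
    · subst hw
      exact ⟨he x, hxe x⟩
    · exact absurd (if_neg hw) h
  apply le_antisymm
  · unfold hypEnt
    refine le_csInf ⟨_, _, ht0, ht1, ht, rfl⟩ ?_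
    rintro r ⟨t, h0, h1, h2, rfl⟩
    refine le_of_forall_pos_le_add fun ε hε => ?_
    unfold optRate
    refine csInf_le ⟨0, fun R hR => hR.1⟩ ?_
    have h := achiev P hP0 hP1 f t h0 h1 h2 (ε / 4) (by linarith)
    rw [mul_div_cancel₀ ε (by norm_num : (4:ℝ) ≠ 0)] at h
    exact h
  · unfold optRate
    exact le_csInf ⟨_, achiev P hP0 hP1 f _ ht0 ht1 ht 1 one_pos⟩
      fun R hR => converse P hP0 hP1 f R hR

end Stmt1
end
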